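/- Let n ≥ 20 be an integer and let p* denote the smallest real root greater than (n−4)/(n−8) of the algebraic equation 512(2−n)x⁶ + 4(n³−60n²+670n−1344)x⁵ − 2(13n³−424n²+3064n−5408)x⁴ + 2(27n³−572n²+3264n−5440)x³ − (49n³−772n²+3776n−5888)x² + 4(5n³−66n²+288n−416)x − 3(n³−12n²+48n−64) = 0. Then for every p with 1 < p < 1 + 8p*/(n−4) there is no stable classical solution of Δ²u = u^p, u > 0, on ℝⁿ. -/

import Mathlib

open MeasureTheory Real RealInnerProductSpace

/-- The Laplacian of `f : ℝⁿ → ℝ`, as the trace of the second derivative. -/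
noncomputable def lap {n : ℕ} (f : EuclideanSpace ℝ (Fin n) → ℝ)
    (x : EuclideanSpace ℝ (Fin n)) : ℝ :=
  ∑ i : Fin n,
    iteratedFDeriv ℝ 2 f x ![EuclideanSpace.single i 1, EuclideanSpace.single i 1]

/-- Squared Frobenius norm of the Hessian of `f : ℝⁿ → ℝ`. -/
noncomputable def hessNormSq {n : ℕ} (f : EuclideanSpace ℝ (Fin n) → ℝ)
    (x : EuclideanSpace ℝ (Fin n)) : ℝ :=
  ∑ i : Fin n, ∑ j : Fin n,
    (iteratedFDeriv ℝ 2 f x ![EuclideanSpace.single i 1, EuclideanSpace.single j 1]) ^ 2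

/-- The quantity `‖∇⁴(φ^{2γ})‖` defined by
`‖∇⁴(φ^{2γ})‖² = φ^{-2γ}|∇φ^γ|⁴ + |φ^γ Δ²φ^γ| + |∇²φ^γ|²`,
with the first term interpreted as `0` where `φ = 0`. -/
noncomputable def norm4 {n : ℕ} (γ : ℝ) (φ : EuclideanSpace ℝ (Fin n) → ℝ)
    (x : EuclideanSpace ℝ (Fin n)) : ℝ :=
  Real.sqrt
    ((if φ x = 0 then 0 else φ x ^ (-(2*γ)) * ‖gradient (fun y => φ y ^ γ) x‖ ^ 4)
      + |φ x ^ γ * lap (lap (fun y => φ y ^ γ)) x|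
      + hessNormSq (fun y => φ y ^ γ) x)

/-- The degree-6 polynomial from the paper whose smallest root above `(n-4)/(n-8)`
defines the exponent `p*`. -/
noncomputable def Pn (n : ℕ) (x : ℝ) : ℝ :=
  512*(2-(n:ℝ))*x^6 + 4*((n:ℝ)^3-60*(n:ℝ)^2+670*(n:ℝ)-1344)*x^5
    - 2*(13*(n:ℝ)^3-424*(n:ℝ)^2+3064*(n:ℝ)-5408)*x^4
    + 2*(27*(n:ℝ)^3-572*(n:ℝ)^2+3264*(n:ℝ)-5440)*x^3
    - (49*(n:ℝ)^3-772*(n:ℝ)^2+3776*(n:ℝ)-5888)*x^2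
    + 4*(5*(n:ℝ)^3-66*(n:ℝ)^2+288*(n:ℝ)-416)*x
    - 3*((n:ℝ)^3-12*(n:ℝ)^2+48*(n:ℝ)-64)

/-- The Euclidean space `ℝⁿ`. -/
abbrev ESp (n : ℕ) := EuclideanSpace ℝ (Fin n)

/-- The `i`-th partial derivative. -/
noncomputable def pd {n : ℕ} (i : Fin n) (f : ESp n → ℝ) (x : ESp n) : ℝ :=
  fderiv ℝ f x (EuclideanSpace.single i 1)

section PartialDerivatives

variable {n : ℕ}

lemma ContDiff.pd {k : ℕ} {f : ESp n → ℝ} (hf : ContDiff ℝ (k + 1 : ℕ) f) (i : Fin n) :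
    ContDiff ℝ k (pd i f) := by
  have h : ContDiff ℝ k (fderiv ℝ f) := hf.fderiv_right (by norm_cast)
  exact h.clm_apply contDiff_const

lemma lap_eq_sum {f : ESp n → ℝ} (hf : ContDiff ℝ 2 f) (x : ESp n) :
    lap f x = ∑ i, pd i (pd i f) x := by
  unfold lap
  refine Finset.sum_congr rfl fun i _ => ?_
  rw [iteratedFDeriv_two_apply]
  have h : Differentiable ℝ (fderiv ℝ f) :=
    (hf.fderiv_right (m := 1) (by norm_num)).differentiable (by norm_num)
  unfold pd
  rw [fderiv_clm_apply h.differentiableAt (by fun_prop)]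
  simp

lemma pd_comm {f : ESp n → ℝ} (hf : ContDiff ℝ 2 f) (i j : Fin n) (x : ESp n) :
    pd i (pd j f) x = pd j (pd i f) x := by
  have h : Differentiable ℝ (fderiv ℝ f) :=
    (hf.fderiv_right (m := 1) (by norm_num)).differentiable (by norm_num)
  have hs : IsSymmSndFDerivAt ℝ f x := hf.contDiffAt.isSymmSndFDerivAt (by simp)
  unfold pd
  rw [fderiv_clm_apply h.differentiableAt (by fun_prop),
    fderiv_clm_apply h.differentiableAt (by fun_prop)]
  simpa using hs _ _

lemma pd_mul {f g : ESp n → ℝ} {x : ESp n} (hf : DifferentiableAt ℝ f x)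
    (hg : DifferentiableAt ℝ g x) (i : Fin n) :
    pd i (fun y => f y * g y) x = pd i f x * g x + f x * pd i g x := by
  unfold pd
  rw [fderiv_fun_mul hf hg]
  simp; ring

lemma pd_add {f g : ESp n → ℝ} {x : ESp n} (hf : DifferentiableAt ℝ f x)
    (hg : DifferentiableAt ℝ g x) (i : Fin n) :
    pd i (fun y => f y + g y) x = pd i f x + pd i g x := by
  unfold pd
  rw [fderiv_fun_add hf hg]
  simp

lemma pd_sub {f g : ESp n → ℝ} {x : ESp n} (hf : DifferentiableAt ℝ f x)
    (hg : DifferentiableAt ℝ g x) (i : Fin n) :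
    pd i (fun y => f y - g y) x = pd i f x - pd i g x := by
  unfold pd
  rw [fderiv_fun_sub hf hg]
  simp

lemma pd_const_mul {f : ESp n → ℝ} {x : ESp n} (hf : DifferentiableAt ℝ f x) (c : ℝ)
    (i : Fin n) : pd i (fun y => c * f y) x = c * pd i f x := by
  unfold pd
  rw [fderiv_const_mul hf]
  simp

lemma pd_comp {f : ESp n → ℝ} {x : ESp n} {h : ℝ → ℝ} {h' : ℝ} (hf : DifferentiableAt ℝ f x)
    (hh : HasDerivAt h h' (f x)) (i : Fin n) :
    pd i (fun y => h (f y)) x = h' * pd i f x := by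
  unfold pd
  have := hh.comp_hasFDerivAt x hf.hasFDerivAt
  rw [show (fun y => h (f y)) = h ∘ f from rfl, this.fderiv]
  simp

lemma pd_rpow {f : ESp n → ℝ} {x : ESp n} (hf : DifferentiableAt ℝ f x) (hx : 0 < f x) (s : ℝ)
    (i : Fin n) : pd i (fun y => f y ^ s) x = s * f x ^ (s - 1) * pd i f x :=
  pd_comp hf (Real.hasDerivAt_rpow_const (Or.inl hx.ne')) i

lemma HasCompactSupport.pd {f : ESp n → ℝ} (hf : HasCompactSupport f) (i : Fin n) :
    HasCompactSupport (pd i f) := by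
  have := hf.fderiv (𝕜 := ℝ)
  exact this.comp_left (g := fun L : ESp n →L[ℝ] ℝ => L (EuclideanSpace.single i 1)) (by simp)

lemma integral_pd_eq_zero {V : ESp n → ℝ} (hV : ContDiff ℝ 1 V) (hc : HasCompactSupport V)
    (i : Fin n) : ∫ x, pd i V x = 0 := by
  have h1 : Integrable V := hV.continuous.integrable_of_hasCompactSupport hc
  have h2 : Integrable (_root_.pd i V) :=
    (ContDiff.pd (k := 0) (by simpa using hV) i).continuous.integrable_of_hasCompactSupport
      (hc.pd i)
  have := integral_mul_fderiv_eq_neg_fderiv_mul_of_integrable (μ := volume) (𝕜 := ℝ) (f := V)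
    (g := fun _ => (1 : ℝ)) (v := EuclideanSpace.single i 1) (by simpa using! h2) (by simp)
    (by simpa using h1) (fun x _ => hV.differentiable (by norm_num) x) (by simp)
  simpa [pd] using this

lemma ContDiff.lap_cd {k : ℕ} {f : ESp n → ℝ} (hf : ContDiff ℝ (k + 2 : ℕ) f) :
    ContDiff ℝ k (lap f) := by
  have h2 : ContDiff ℝ 2 f := hf.of_le (by norm_cast; omega)
  rw [show lap f = fun x => ∑ i, _root_.pd i (_root_.pd i f) x from funext (lap_eq_sum h2)]
  exact ContDiff.sum fun i _ => (ContDiff.pd (hf.pd i) i)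

lemma HasCompactSupport.lap {f : ESp n → ℝ} (hf : HasCompactSupport f) (h2 : ContDiff ℝ 2 f) :
    HasCompactSupport (lap f) := by
  rw [show _root_.lap f = fun x => ∑ i, _root_.pd i (_root_.pd i f) x from funext (lap_eq_sum h2)]
  refine HasCompactSupport.intro hf.isCompact fun x hx => ?_
  refine Finset.sum_eq_zero fun i _ => ?_
  by_contra hne
  have h1 : x ∈ tsupport (_root_.pd i (_root_.pd i f)) := subset_tsupport _ hne
  have key : ∀ g : ESp n → ℝ, tsupport (_root_.pd i g) ⊆ tsupport g := fun g =>
    (closure_mono (fun y hy => by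
      intro h0
      exact hy (by simp [_root_.pd, h0]))).trans (tsupport_fderiv_subset ℝ)
  exact hx (key f (key _ h1))

/-- Green's second identity for a compactly supported function. -/
lemma integral_mul_lap {f g : ESp n → ℝ} (hf : ContDiff ℝ 2 f) (hg : ContDiff ℝ 2 g)
    (hc : HasCompactSupport g) : ∫ x, lap f x * g x = ∫ x, f x * lap g x := by
  have h : ∀ i : Fin n, ∫ x, (pd i (pd i f) x * g x - f x * pd i (pd i g) x) = 0 := by
    intro i
    have df : ∀ x, DifferentiableAt ℝ f x := fun x => hf.differentiable (by norm_num) x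
    have dg : ∀ x, DifferentiableAt ℝ g x := fun x => hg.differentiable (by norm_num) x
    have cf : ContDiff ℝ 1 (pd i f) := ContDiff.pd (k := 1) hf i
    have cg : ContDiff ℝ 1 (pd i g) := ContDiff.pd (k := 1) hg i
    have ddf : ∀ x, DifferentiableAt ℝ (pd i f) x := fun x => cf.differentiable (by norm_num) x
    have ddg : ∀ x, DifferentiableAt ℝ (pd i g) x := fun x => cg.differentiable (by norm_num) x
    have e := integral_pd_eq_zero (V := fun x => pd i f x * g x - f x * pd i g x)
      ((cf.mul (hg.of_le (by norm_num))).sub ((hf.of_le (by norm_num)).mul cg))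
      ((hc.mul_left).sub ((hc.pd i).mul_left)) i
    rw [← e]
    refine integral_congr_ae (Filter.Eventually.of_forall fun x => ?_)
    simp only
    rw [pd_sub ((ddf x).fun_mul (dg x)) ((df x).fun_mul (ddg x)), pd_mul (ddf x) (dg x),
      pd_mul (df x) (ddg x)]
    ring
  have i1 : Integrable (fun x => lap f x * g x) :=
    ((ContDiff.lap_cd (k := 0) hf).continuous.mul hg.continuous).integrable_of_hasCompactSupport
      hc.mul_left
  have i2 : Integrable (fun x => f x * lap g x) :=
    (hf.continuous.mul (ContDiff.lap_cd (k := 0) hg).continuous).integrable_of_hasCompactSupport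
      (hc.lap hg).mul_left
  rw [← sub_eq_zero, ← integral_sub i1 i2]
  have i3 : ∀ i : Fin n, Integrable (fun x => pd i (pd i f) x * g x - f x * pd i (pd i g) x) := by
    intro i
    have c1 : ∀ {h : ESp n → ℝ}, ContDiff ℝ 2 h → Continuous (pd i (pd i h)) := fun hh =>
      (ContDiff.pd (k := 0) (ContDiff.pd (k := 1) hh i) i).continuous
    exact (((c1 hf).mul hg.continuous).sub (hf.continuous.mul
      (c1 hg))).integrable_of_hasCompactSupport
      ((hc.mul_left).sub (((hc.pd i).pd i).mul_left))
  calc _ = ∫ x, ∑ i, (pd i (pd i f) x * g x - f x * pd i (pd i g) x) := by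
        refine integral_congr_ae (Filter.Eventually.of_forall fun x => ?_)
        simp only
        rw [lap_eq_sum hf, lap_eq_sum hg, Finset.sum_sub_distrib, Finset.sum_mul, Finset.mul_sum]
    _ = 0 := by
        rw [integral_finsetSum _ fun i _ => i3 i]
        exact Finset.sum_eq_zero fun i _ => h i

end PartialDerivatives

/-- The `m`-th power of the positive part. -/
noncomputable def posPow (m : ℕ) (y : ℝ) : ℝ := (max 0 y) ^ m

lemma posPow_nonneg (m : ℕ) (y : ℝ) : 0 ≤ posPow m y := pow_nonneg (le_max_left _ _) _

lemma posPow_of_nonpos {m : ℕ} (hm : m ≠ 0) {y : ℝ} (hy : y ≤ 0) : posPow m y = 0 := by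
  simp [posPow, max_eq_left hy, hm]

lemma posPow_of_nonneg (m : ℕ) {y : ℝ} (hy : 0 ≤ y) : posPow m y = y ^ m := by
  simp [posPow, max_eq_right hy]

lemma hasDerivAt_posPow (m : ℕ) (hm : 1 ≤ m) (y : ℝ) :
    HasDerivAt (posPow (m + 1)) ((m + 1) * posPow m y) y := by
  rcases lt_trichotomy y 0 with h | h | h
  · rw [posPow_of_nonpos (by omega) h.le, mul_zero]
    refine (hasDerivAt_const y (0 : ℝ)).congr_of_eventuallyEq ?_
    filter_upwards [eventually_lt_nhds h] with z hz
    exact posPow_of_nonpos (by omega) hz.le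
  · subst h
    rw [posPow_of_nonpos (by omega) le_rfl, mul_zero]
    rw [hasDerivAt_iff_isLittleO]
    have : (fun x : ℝ => posPow (m + 1) x) =O[nhds 0] fun x : ℝ => x ^ (m + 1) := by
      refine Asymptotics.IsBigO.of_bound 1 (Filter.Eventually.of_forall fun x => ?_)
      rw [one_mul, Real.norm_of_nonneg (posPow_nonneg _ _), norm_pow]
      exact pow_le_pow_left₀ (le_max_left _ _) (max_le (norm_nonneg _) (le_abs_self _)) _
    refine (this.trans_isLittleO ?_).congr_left ?_ |>.congr_right ?_ (g₁ := fun x => x)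
    · simpa using Asymptotics.isLittleO_pow_pow (𝕜 := ℝ) (m := 1) (n := m + 1) (by omega)
    · intro x; simp [posPow_of_nonpos (m := m + 1) (by omega) le_rfl]
    · simp
  · have := hasDerivAt_pow (m + 1) y
    rw [posPow_of_nonneg m h.le]
    refine HasDerivAt.congr_of_eventuallyEq (by simpa using this) ?_
    filter_upwards [eventually_gt_nhds h] with z hz
    exact posPow_of_nonneg _ hz.le

lemma continuous_posPow (m : ℕ) : Continuous (posPow m) := by
  unfold posPow; fun_prop

lemma contDiff_posPow (k : ℕ) (m : ℕ) (h : k < m) : ContDiff ℝ k (posPow m) := by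
  induction k generalizing m with
  | zero => exact contDiff_zero.2 (continuous_posPow m)
  | succ k ih =>
    obtain ⟨m, rfl⟩ : ∃ l, m = l + 1 := ⟨m - 1, by omega⟩
    have hd := hasDerivAt_posPow m (by omega)
    have : ContDiff ℝ ((k : WithTop ℕ∞) + 1) (posPow (m + 1)) := by
      rw [contDiff_succ_iff_deriv]
      refine ⟨fun y => (hd y).differentiableAt, by simp, ?_⟩
      rw [show deriv (posPow (m + 1)) = fun y => (m + 1) * posPow m y from
        funext fun y => (hd y).deriv]
      exact contDiff_const.mul (ih m (by omega))
    exact_mod_cast this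

section Cutoff

variable {n : ℕ}

/-- The quadratic profile `1 - |x - x₀|² / R²`. -/
noncomputable def quadBump (x₀ : ESp n) (R : ℝ) (x : ESp n) : ℝ := 1 - ‖x - x₀‖ ^ 2 / R ^ 2

/-- The cut-off function `(1 - |x - x₀|² / R²)₊ ^ m`. -/
noncomputable def cut (x₀ : ESp n) (R : ℝ) (m : ℕ) (x : ESp n) : ℝ := posPow m (quadBump x₀ R x)

lemma contDiff_quadBump (x₀ : ESp n) (R : ℝ) {k : WithTop ℕ∞} : ContDiff ℝ k (quadBump x₀ R) := by
  unfold quadBump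
  exact contDiff_const.sub (((contDiff_id.sub contDiff_const).norm_sq ℝ).div_const _)

lemma pd_quadBump (x₀ : ESp n) (R : ℝ) (x : ESp n) (i : Fin n) :
    pd i (quadBump x₀ R) x = -2 * (x i - x₀ i) / R ^ 2 := by
  have h1 : HasFDerivAt (fun y : ESp n => ‖y - x₀‖ ^ 2) _ x :=
    ((hasFDerivAt_id x).sub_const x₀).norm_sq
  have h2 := (h1.mul_const ((R ^ 2)⁻¹)).const_sub 1
  unfold pd
  rw [show quadBump x₀ R = fun y => 1 - ‖y - x₀‖ ^ 2 * (R ^ 2)⁻¹ from by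
    funext y; simp [quadBump, div_eq_mul_inv], h2.fderiv]
  simp [EuclideanSpace.inner_single_right]
  ring

lemma sum_pd_quadBump_sq (x₀ : ESp n) (R : ℝ) (x : ESp n) :
    ∑ i, (pd i (quadBump x₀ R) x) ^ 2 = 4 * ‖x - x₀‖ ^ 2 / R ^ 4 := by
  rw [EuclideanSpace.norm_sq_eq, Finset.mul_sum, Finset.sum_div]
  refine Finset.sum_congr rfl fun i _ => ?_
  rw [pd_quadBump, Real.norm_eq_abs, sq_abs]
  simp
  ring

lemma contDiff_cut (x₀ : ESp n) (R : ℝ) {k m : ℕ} (h : k < m) : ContDiff ℝ k (cut x₀ R m) :=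
  (contDiff_posPow k m h).comp (contDiff_quadBump x₀ R)

lemma continuous_cut (x₀ : ESp n) (R : ℝ) (m : ℕ) : Continuous (cut x₀ R m) :=
  (continuous_posPow m).comp (contDiff_quadBump x₀ R (k := 0)).continuous

lemma cut_nonneg (x₀ : ESp n) (R : ℝ) (m : ℕ) (x : ESp n) : 0 ≤ cut x₀ R m x := posPow_nonneg _ _

lemma quadBump_le_one (x₀ : ESp n) (R : ℝ) (x : ESp n) : quadBump x₀ R x ≤ 1 := by
  unfold quadBump
  have : 0 ≤ ‖x - x₀‖ ^ 2 / R ^ 2 := by positivity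
  linarith

lemma cut_le_one (x₀ : ESp n) (R : ℝ) (m : ℕ) (x : ESp n) : cut x₀ R m x ≤ 1 :=
  pow_le_one₀ (le_max_left _ _) (max_le zero_le_one (quadBump_le_one _ _ _))

lemma cut_anti (x₀ : ESp n) (R : ℝ) {k m : ℕ} (h : k ≤ m) (x : ESp n) :
    cut x₀ R m x ≤ cut x₀ R k x :=
  pow_le_pow_of_le_one (le_max_left _ _) (max_le zero_le_one (quadBump_le_one _ _ _)) h

lemma cut_mono (x₀ : ESp n) {R R' : ℝ} (hR : 0 < R) (h : R ≤ R') (m : ℕ) (x : ESp n) :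
    cut x₀ R m x ≤ cut x₀ R' m x := by
  refine pow_le_pow_left₀ (le_max_left _ _) (max_le_max le_rfl ?_) _
  unfold quadBump
  gcongr

lemma quadBump_pos_iff (x₀ : ESp n) {R : ℝ} (hR : 0 < R) (x : ESp n) :
    0 < quadBump x₀ R x ↔ ‖x - x₀‖ < R := by
  unfold quadBump
  rw [sub_pos, div_lt_one (by positivity)]
  exact pow_lt_pow_iff_left₀ (norm_nonneg _) hR.le (by norm_num)

lemma cut_eq_zero (x₀ : ESp n) {R : ℝ} (hR : 0 < R) {m : ℕ} (hm : m ≠ 0) {x : ESp n}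
    (hx : R ≤ ‖x - x₀‖) : cut x₀ R m x = 0 := by
  refine posPow_of_nonpos hm ?_
  by_contra h
  exact absurd ((quadBump_pos_iff x₀ hR x).1 (not_le.1 h)) (not_lt.2 hx)

lemma hasCompactSupport_cut (x₀ : ESp n) {R : ℝ} (hR : 0 < R) {m : ℕ} (hm : m ≠ 0) :
    HasCompactSupport (cut x₀ R m) := by
  refine HasCompactSupport.intro (isCompact_closedBall x₀ R) fun x hx => cut_eq_zero x₀ hR hm ?_
  rw [Metric.mem_closedBall, dist_eq_norm, not_le] at hx
  exact hx.le

lemma pd_cut (x₀ : ESp n) (R : ℝ) {m : ℕ} (hm : 1 ≤ m) (x : ESp n) (i : Fin n) :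
    pd i (cut x₀ R (m + 1)) x = (m + 1) * cut x₀ R m x * pd i (quadBump x₀ R) x :=
  pd_comp ((contDiff_quadBump x₀ R (k := 1)).differentiable (by norm_num) x)
    (hasDerivAt_posPow m hm _) i

lemma lap_cut (x₀ : ESp n) (R : ℝ) {m : ℕ} (hm : 1 ≤ m) (x : ESp n) :
    lap (cut x₀ R (m + 2)) x = (m + 2) * (m + 1) * cut x₀ R m x * (4 * ‖x - x₀‖ ^ 2 / R ^ 4)
      - 2 * n * (m + 2) * cut x₀ R (m + 1) x / R ^ 2 := by
  rw [lap_eq_sum (contDiff_cut x₀ R (k := 2) (by omega)), ← sum_pd_quadBump_sq]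
  have h : ∀ i : Fin n, pd i (pd i (cut x₀ R (m + 2))) x =
      (m + 2) * (m + 1) * cut x₀ R m x * (pd i (quadBump x₀ R) x) ^ 2
        - 2 * (m + 2) * cut x₀ R (m + 1) x / R ^ 2 := by
    intro i
    have e : pd i (cut x₀ R (m + 2)) = fun y => cut x₀ R (m + 1) y *
        ((m + 2 : ℝ) * pd i (quadBump x₀ R) y) := by
      funext y
      rw [pd_cut x₀ R (by omega)]
      push_cast; ring
    have dc : DifferentiableAt ℝ (cut x₀ R (m + 1)) x :=
      (contDiff_cut x₀ R (k := 1) (by omega)).differentiable (by norm_num) x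
    have cq : ContDiff ℝ 1 (pd i (quadBump x₀ R)) :=
      ContDiff.pd (k := 1) (contDiff_quadBump x₀ R) i
    have dq : DifferentiableAt ℝ (pd i (quadBump x₀ R)) x := cq.differentiable (by norm_num) x
    rw [e, pd_mul dc (dq.const_mul _), pd_const_mul dq, pd_cut x₀ R hm]
    have e2 : pd i (pd i (quadBump x₀ R)) x = -2 / R ^ 2 := by
      rw [show pd i (quadBump x₀ R) = fun y => -2 * (y i - x₀ i) / R ^ 2 from
        funext fun y => pd_quadBump x₀ R y i]
      have h1 : HasFDerivAt (fun y : ESp n => y i) (EuclideanSpace.proj (𝕜 := ℝ) i) x :=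
        (EuclideanSpace.proj (𝕜 := ℝ) i).hasFDerivAt
      have h2 := ((h1.sub_const (x₀ i)).const_mul (-2)).mul_const ((R ^ 2)⁻¹)
      simp only [div_eq_mul_inv]
      unfold pd
      rw [h2.fderiv]
      simp
      ring
    rw [e2]
    ring
  simp_rw [h]
  rw [Finset.sum_sub_distrib, ← Finset.mul_sum]
  simp
  ring

lemma sum_pd_quadBump_sq_le (x₀ : ESp n) {R : ℝ} (hR : 0 < R) {x : ESp n}
    (hx : 0 < quadBump x₀ R x) : ∑ i, (pd i (quadBump x₀ R) x) ^ 2 ≤ 4 / R ^ 2 := by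
  rw [sum_pd_quadBump_sq]
  have h := (quadBump_pos_iff x₀ hR x).1 hx
  calc 4 * ‖x - x₀‖ ^ 2 / R ^ 4 ≤ 4 * R ^ 2 / R ^ 4 := by gcongr
    _ = 4 / R ^ 2 := by field_simp

lemma abs_lap_cut_le (x₀ : ESp n) {R : ℝ} (hR : 0 < R) {m : ℕ} (hm : 1 ≤ m) (x : ESp n) :
    |lap (cut x₀ R (m + 2)) x|
      ≤ ((m + 2) * (m + 1) * 4 + 2 * n * (m + 2)) * cut x₀ R m x / R ^ 2 := by
  rcases le_or_gt R ‖x - x₀‖ with h | h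
  · rw [lap_cut x₀ R hm, cut_eq_zero x₀ hR (by omega) h, cut_eq_zero x₀ hR (by omega) h]
    simp
  · rw [lap_cut x₀ R hm]
    have h1 : 4 * ‖x - x₀‖ ^ 2 / R ^ 4 ≤ 4 / R ^ 2 := by
      calc 4 * ‖x - x₀‖ ^ 2 / R ^ 4 ≤ 4 * R ^ 2 / R ^ 4 := by gcongr
        _ = 4 / R ^ 2 := by field_simp
    have h2 := cut_anti x₀ R (show m ≤ m + 1 by omega) x
    have h3 := cut_nonneg x₀ R m x
    have h4 := cut_nonneg x₀ R (m + 1) x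
    refine (abs_sub _ _).trans ?_
    rw [abs_of_nonneg (by positivity), abs_of_nonneg (by positivity)]
    calc _ ≤ (m + 2) * (m + 1) * cut x₀ R m x * (4 / R ^ 2)
          + 2 * n * (m + 2) * cut x₀ R m x / R ^ 2 := by gcongr
      _ = _ := by ring

end Cutoff

section Identities

variable {n : ℕ}

/-- `|∇u|²`. -/
noncomputable def gradSq (u : ESp n → ℝ) (x : ESp n) : ℝ := ∑ i, (pd i u x) ^ 2

/-- `|D²u|²`. -/
noncomputable def hessSq (u : ESp n → ℝ) (x : ESp n) : ℝ := ∑ i, ∑ j, (pd i (pd j u) x) ^ 2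

/-- `D²u(∇u, ∇u)`. -/
noncomputable def hessGrad (u : ESp n → ℝ) (x : ESp n) : ℝ :=
  ∑ i, ∑ j, pd i u x * pd j u x * pd i (pd j u) x

/-- `∇u · ∇T`. -/
noncomputable def gradDot (u T : ESp n → ℝ) (x : ESp n) : ℝ := ∑ i, pd i u x * pd i T x

/-- `D²u(∇u, ∇T)`. -/
noncomputable def hessDot (u T : ESp n → ℝ) (x : ESp n) : ℝ :=
  ∑ i, ∑ j, pd i u x * pd j T x * pd i (pd j u) x

lemma gradSq_nonneg (u : ESp n → ℝ) (x : ESp n) : 0 ≤ gradSq u x :=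
  Finset.sum_nonneg fun _ _ => sq_nonneg _

lemma hessSq_nonneg (u : ESp n → ℝ) (x : ESp n) : 0 ≤ hessSq u x :=
  Finset.sum_nonneg fun _ _ => Finset.sum_nonneg fun _ _ => sq_nonneg _

lemma gradDot_sq_le (u T : ESp n → ℝ) (x : ESp n) :
    gradDot u T x ^ 2 ≤ gradSq u x * ∑ i, (pd i T x) ^ 2 :=
  Finset.sum_mul_sq_le_sq_mul_sq _ _ _

lemma hessDot_sq_le (u T : ESp n → ℝ) (x : ESp n) :
    hessDot u T x ^ 2 ≤ gradSq u x * (∑ i, (pd i T x) ^ 2) * hessSq u x := by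
  unfold hessDot hessSq gradSq
  rw [Finset.sum_mul_sum, ← Finset.sum_product', ← Finset.sum_product', ← Finset.sum_product']
  refine (Finset.sum_mul_sq_le_sq_mul_sq _ _ _).trans (le_of_eq ?_)
  simp only [mul_pow]

lemma hessGrad_sq_le (u : ESp n → ℝ) (x : ESp n) :
    hessGrad u x ^ 2 ≤ gradSq u x ^ 2 * hessSq u x := by
  have := hessDot_sq_le u u x
  rw [sq (gradSq u x)]
  exact this

lemma continuous_pd {u : ESp n → ℝ} (hu : ContDiff ℝ 1 u) (i : Fin n) : Continuous (pd i u) :=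
  (ContDiff.pd (k := 0) (by simpa using hu) i).continuous

lemma continuous_pd_pd {u : ESp n → ℝ} (hu : ContDiff ℝ 2 u) (i j : Fin n) :
    Continuous (pd i (pd j u)) :=
  continuous_pd (ContDiff.pd (k := 1) hu j) i

lemma continuous_gradSq {u : ESp n → ℝ} (hu : ContDiff ℝ 1 u) : Continuous (gradSq u) :=
  continuous_finsetSum _ fun i _ => (continuous_pd hu i).pow 2

lemma continuous_hessSq {u : ESp n → ℝ} (hu : ContDiff ℝ 2 u) : Continuous (hessSq u) :=
  continuous_finsetSum _ fun i _ => continuous_finsetSum _ fun j _ =>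
    (continuous_pd_pd hu i j).pow 2

lemma continuous_hessGrad {u : ESp n → ℝ} (hu : ContDiff ℝ 2 u) : Continuous (hessGrad u) := by
  have h1 : ContDiff ℝ 1 u := hu.of_le (by norm_num)
  exact continuous_finsetSum _ fun i _ => continuous_finsetSum _ fun j _ =>
    ((continuous_pd h1 i).mul (continuous_pd h1 j)).mul (continuous_pd_pd hu i j)

lemma continuous_gradDot {u T : ESp n → ℝ} (hu : ContDiff ℝ 1 u) (hT : ContDiff ℝ 1 T) :
    Continuous (gradDot u T) :=
  continuous_finsetSum _ fun i _ => (continuous_pd hu i).mul (continuous_pd hT i)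

lemma continuous_hessDot {u T : ESp n → ℝ} (hu : ContDiff ℝ 2 u) (hT : ContDiff ℝ 1 T) :
    Continuous (hessDot u T) := by
  have h1 : ContDiff ℝ 1 u := hu.of_le (by norm_num)
  exact continuous_finsetSum _ fun i _ => continuous_finsetSum _ fun j _ =>
    ((continuous_pd h1 i).mul (continuous_pd hT j)).mul (continuous_pd_pd hu i j)

lemma continuous_lap {u : ESp n → ℝ} (hu : ContDiff ℝ 2 u) : Continuous (lap u) :=
  (ContDiff.lap_cd (k := 0) hu).continuous

/-- The Laplacian of `u ^ κ * T`. -/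
lemma lap_rpow_mul {u T : ESp n → ℝ} (hu : ContDiff ℝ 2 u) (hpos : ∀ x, 0 < u x)
    (hT : ContDiff ℝ 2 T) (κ : ℝ) (x : ESp n) :
    lap (fun y => u y ^ κ * T y) x = κ * u x ^ (κ - 1) * lap u x * T x
      + κ * (κ - 1) * u x ^ (κ - 2) * gradSq u x * T x
      + 2 * κ * u x ^ (κ - 1) * gradDot u T x + u x ^ κ * lap T x := by
  have hk : ∀ κ : ℝ, ContDiff ℝ 2 fun y => u y ^ κ := fun κ =>
    hu.rpow_const_of_ne fun x => (hpos x).ne'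
  have du : ∀ x, DifferentiableAt ℝ u x := fun x => hu.differentiable (by norm_num) x
  have dT : ∀ x, DifferentiableAt ℝ T x := fun x => hT.differentiable (by norm_num) x
  have dk : ∀ (κ : ℝ) (x : ESp n), DifferentiableAt ℝ (fun y => u y ^ κ) x := fun κ x =>
    (hk κ).differentiable (by norm_num) x
  have h : ∀ i : Fin n, pd i (pd i fun y => u y ^ κ * T y) x =
      κ * u x ^ (κ - 1) * pd i (pd i u) x * T x
      + κ * (κ - 1) * u x ^ (κ - 2) * (pd i u x) ^ 2 * T x
      + 2 * κ * u x ^ (κ - 1) * (pd i u x * pd i T x) + u x ^ κ * pd i (pd i T) x := by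
    intro i
    have d2u : DifferentiableAt ℝ (pd i u) x :=
      (ContDiff.pd (k := 1) hu i).differentiable (by norm_num) x
    have d2T : DifferentiableAt ℝ (pd i T) x :=
      (ContDiff.pd (k := 1) hT i).differentiable (by norm_num) x
    have e : (pd i fun y => u y ^ κ * T y) = fun y =>
        κ * (u y ^ (κ - 1) * (pd i u y * T y)) + u y ^ κ * pd i T y := by
      funext y
      rw [pd_mul (dk κ y) (dT y), pd_rpow (du y) (hpos y)]
      ring
    rw [e, pd_add (((dk _ x).fun_mul (d2u.fun_mul (dT x))).const_mul _)
      ((dk _ x).fun_mul d2T), pd_const_mul ((dk _ x).fun_mul (d2u.fun_mul (dT x))),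
      pd_mul (dk _ x) (d2u.fun_mul (dT x)), pd_mul d2u (dT x), pd_mul (dk _ x) d2T,
      pd_rpow (du x) (hpos x), pd_rpow (du x) (hpos x), show κ - 1 - 1 = κ - 2 by ring]
    ring
  rw [lap_eq_sum ((hk κ).mul hT), lap_eq_sum hu, lap_eq_sum hT]
  simp_rw [h]
  unfold gradSq gradDot
  simp only [Finset.sum_add_distrib, Finset.mul_sum, Finset.sum_mul]

/-- `∫ div (u ^ κ T ∇u) = 0`. -/
lemma integral_div_rpow_grad {u T : ESp n → ℝ} (hu : ContDiff ℝ 2 u) (hpos : ∀ x, 0 < u x)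
    (hT : ContDiff ℝ 1 T) (hc : HasCompactSupport T) (κ : ℝ) :
    ∫ x, (u x ^ κ * T x * lap u x + κ * u x ^ (κ - 1) * T x * gradSq u x
      + u x ^ κ * gradDot u T x) = 0 := by
  have hk : ContDiff ℝ 1 fun y => u y ^ κ :=
    (hu.of_le (by norm_num)).rpow_const_of_ne fun x => (hpos x).ne'
  have c2 : ∀ i, ContDiff ℝ 1 (pd i u) := fun i => ContDiff.pd (k := 1) hu i
  have cV : ∀ i : Fin n, ContDiff ℝ 1 fun y => u y ^ κ * T y * pd i u y := fun i =>
    (hk.mul hT).mul (c2 i)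
  have sV : ∀ i : Fin n, HasCompactSupport fun y => u y ^ κ * T y * pd i u y := fun i =>
    hc.mul_left.mul_right
  calc _ = ∫ x, ∑ i, pd i (fun y => u y ^ κ * T y * pd i u y) x := by
        refine integral_congr_ae (Filter.Eventually.of_forall fun x => ?_)
        have du := hu.differentiable (by norm_num) x
        have dk := hk.differentiable (by norm_num) x
        have dT := hT.differentiable (by norm_num) x
        have h : ∀ i : Fin n, pd i (fun y => u y ^ κ * T y * pd i u y) x =
            u x ^ κ * T x * pd i (pd i u) x + κ * u x ^ (κ - 1) * T x * (pd i u x) ^ 2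
              + u x ^ κ * (pd i u x * pd i T x) := by
          intro i
          rw [pd_mul (dk.fun_mul dT) ((c2 i).differentiable (by norm_num) x), pd_mul dk dT,
            pd_rpow du (hpos x)]
          ring
        simp_rw [h]
        rw [lap_eq_sum hu]
        unfold gradSq gradDot
        simp only [Finset.sum_add_distrib, Finset.mul_sum]
    _ = 0 := by
        rw [integral_finsetSum _ fun i _ => (continuous_pd (cV i) i).integrable_of_hasCompactSupport
          ((sV i).pd i)]
        exact Finset.sum_eq_zero fun i _ => integral_pd_eq_zero (cV i) (sV i) i

/-- `∫ div (u ^ κ T |∇u|² ∇u) = 0`. -/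
lemma integral_div_rpow_gradSq {u T : ESp n → ℝ} (hu : ContDiff ℝ 2 u) (hpos : ∀ x, 0 < u x)
    (hT : ContDiff ℝ 1 T) (hc : HasCompactSupport T) (κ : ℝ) :
    ∫ x, (κ * u x ^ (κ - 1) * T x * gradSq u x ^ 2
      + u x ^ κ * T x * (2 * hessGrad u x + gradSq u x * lap u x)
      + u x ^ κ * gradSq u x * gradDot u T x) = 0 := by
  have hk : ContDiff ℝ 1 fun y => u y ^ κ :=
    (hu.of_le (by norm_num)).rpow_const_of_ne fun x => (hpos x).ne'
  have c2 : ∀ i, ContDiff ℝ 1 (pd i u) := fun i => ContDiff.pd (k := 1) hu i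
  have cV : ∀ i j : Fin n, ContDiff ℝ 1 fun y => u y ^ κ * T y * (pd i u y * pd i u y * pd j u y) :=
    fun i j => (hk.mul hT).mul (((c2 i).mul (c2 i)).mul (c2 j))
  have sV : ∀ i j : Fin n,
      HasCompactSupport fun y => u y ^ κ * T y * (pd i u y * pd i u y * pd j u y) := fun i j =>
    hc.mul_left.mul_right
  calc _ = ∫ x, ∑ i, ∑ j, pd j (fun y => u y ^ κ * T y * (pd i u y * pd i u y * pd j u y)) x := by
        refine integral_congr_ae (Filter.Eventually.of_forall fun x => ?_)
        have du := hu.differentiable (by norm_num) x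
        have dk := hk.differentiable (by norm_num) x
        have dT := hT.differentiable (by norm_num) x
        have d2 : ∀ i, DifferentiableAt ℝ (pd i u) x := fun i =>
          (c2 i).differentiable (by norm_num) x
        have h : ∀ i j : Fin n,
            pd j (fun y => u y ^ κ * T y * (pd i u y * pd i u y * pd j u y)) x =
            κ * u x ^ (κ - 1) * T x * ((pd i u x) ^ 2 * (pd j u x) ^ 2)
            + u x ^ κ * T x * (2 * (pd i u x * pd j u x * pd i (pd j u) x)
              + (pd i u x) ^ 2 * pd j (pd j u) x)
            + u x ^ κ * ((pd i u x) ^ 2 * (pd j u x * pd j T x)) := by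
          intro i j
          rw [pd_mul (dk.fun_mul dT) (((d2 i).fun_mul (d2 i)).fun_mul (d2 j)), pd_mul dk dT,
            pd_rpow du (hpos x), pd_mul ((d2 i).fun_mul (d2 i)) (d2 j), pd_mul (d2 i) (d2 i),
            pd_comm hu j i]
          ring
        simp_rw [h]
        rw [lap_eq_sum hu]
        unfold gradSq gradDot hessGrad
        simp only [Finset.sum_add_distrib, ← Finset.mul_sum, ← Finset.sum_mul]
        ring
    _ = 0 := by
        have hi : ∀ i j : Fin n, Integrable
            (pd j (fun y => u y ^ κ * T y * (pd i u y * pd i u y * pd j u y))) := fun i j =>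
          (continuous_pd (cV i j) j).integrable_of_hasCompactSupport ((sV i j).pd j)
        rw [integral_finsetSum _ fun i _ => integrable_finsetSum _ fun j _ => hi i j]
        refine Finset.sum_eq_zero fun i _ => ?_
        rw [integral_finsetSum _ fun j _ => hi i j]
        exact Finset.sum_eq_zero fun j _ => integral_pd_eq_zero (cV i j) (sV i j) j

/-- `∫ div (u ^ κ T (D²u ∇u - Δu ∇u)) = 0`. -/
lemma integral_div_rpow_hess {u T : ESp n → ℝ} (hu : ContDiff ℝ 3 u) (hpos : ∀ x, 0 < u x)
    (hT : ContDiff ℝ 1 T) (hc : HasCompactSupport T) (κ : ℝ) :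
    ∫ x, (u x ^ κ * T x * (hessSq u x - lap u x ^ 2)
      + κ * u x ^ (κ - 1) * T x * (hessGrad u x - gradSq u x * lap u x)
      + u x ^ κ * (hessDot u T x - gradDot u T x * lap u x)) = 0 := by
  have hu2 : ContDiff ℝ 2 u := hu.of_le (by norm_num)
  have hk : ContDiff ℝ 1 fun y => u y ^ κ :=
    (hu.of_le (by norm_num)).rpow_const_of_ne fun x => (hpos x).ne'
  have c2 : ∀ i, ContDiff ℝ 2 (pd i u) := fun i => ContDiff.pd (k := 2) hu i
  have c21 : ∀ i, ContDiff ℝ 1 (pd i u) := fun i => (c2 i).of_le (by norm_num)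
  have c3 : ∀ i j, ContDiff ℝ 1 (pd i (pd j u)) := fun i j => ContDiff.pd (k := 1) (c2 j) i
  have cV : ∀ i j : Fin n, ContDiff ℝ 1 fun y => u y ^ κ * T y * (pd i u y * pd i (pd j u) y) :=
    fun i j => (hk.mul hT).mul ((c21 i).mul (c3 i j))
  have cW : ∀ i j : Fin n, ContDiff ℝ 1 fun y => u y ^ κ * T y * (pd i u y * pd j (pd j u) y) :=
    fun i j => (hk.mul hT).mul ((c21 i).mul (c3 j j))
  have sV : ∀ i j : Fin n,
      HasCompactSupport fun y => u y ^ κ * T y * (pd i u y * pd i (pd j u) y) := fun i j =>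
    hc.mul_left.mul_right
  have sW : ∀ i j : Fin n,
      HasCompactSupport fun y => u y ^ κ * T y * (pd i u y * pd j (pd j u) y) := fun i j =>
    hc.mul_left.mul_right
  calc _ = ∫ x, ∑ i, ∑ j, (pd j (fun y => u y ^ κ * T y * (pd i u y * pd i (pd j u) y)) x
          - pd i (fun y => u y ^ κ * T y * (pd i u y * pd j (pd j u) y)) x) := by
        refine integral_congr_ae (Filter.Eventually.of_forall fun x => ?_)
        have du := hu.differentiable (by norm_num) x
        have dk := hk.differentiable (by norm_num) x
        have dT := hT.differentiable (by norm_num) x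
        have d2 : ∀ i, DifferentiableAt ℝ (pd i u) x := fun i =>
          (c2 i).differentiable (by norm_num) x
        have d3 : ∀ i j, DifferentiableAt ℝ (pd i (pd j u)) x := fun i j =>
          (c3 i j).differentiable (by norm_num) x
        have h : ∀ i j : Fin n,
            pd j (fun y => u y ^ κ * T y * (pd i u y * pd i (pd j u) y)) x
              - pd i (fun y => u y ^ κ * T y * (pd i u y * pd j (pd j u) y)) x =
            u x ^ κ * T x * ((pd i (pd j u) x) ^ 2 - pd i (pd i u) x * pd j (pd j u) x)
            + κ * u x ^ (κ - 1) * T x * (pd i u x * pd j u x * pd i (pd j u) x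
              - (pd i u x) ^ 2 * pd j (pd j u) x)
            + u x ^ κ * (pd i u x * pd j T x * pd i (pd j u) x
              - (pd i u x * pd i T x) * pd j (pd j u) x) := by
          intro i j
          rw [pd_mul (dk.fun_mul dT) ((d2 i).fun_mul (d3 i j)),
            pd_mul (dk.fun_mul dT) ((d2 i).fun_mul (d3 j j)), pd_mul dk dT, pd_mul dk dT,
            pd_rpow du (hpos x), pd_rpow du (hpos x), pd_mul (d2 i) (d3 i j),
            pd_mul (d2 i) (d3 j j), pd_comm hu2 j i, pd_comm (c2 j) j i]
          ring
        simp_rw [h]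
        rw [lap_eq_sum hu2]
        unfold gradSq gradDot hessGrad hessSq hessDot
        simp only [Finset.sum_add_distrib, Finset.sum_sub_distrib, ← Finset.mul_sum,
          ← Finset.sum_mul]
        ring
    _ = 0 := by
        have hi : ∀ i j : Fin n, Integrable
            (pd j (fun y => u y ^ κ * T y * (pd i u y * pd i (pd j u) y))) := fun i j =>
          (continuous_pd (cV i j) j).integrable_of_hasCompactSupport ((sV i j).pd j)
        have hi' : ∀ i j : Fin n, Integrable
            (pd i (fun y => u y ^ κ * T y * (pd i u y * pd j (pd j u) y))) := fun i j =>
          (continuous_pd (cW i j) i).integrable_of_hasCompactSupport ((sW i j).pd i)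
        have hs : ∀ i j : Fin n, Integrable fun x =>
            pd j (fun y => u y ^ κ * T y * (pd i u y * pd i (pd j u) y)) x
              - pd i (fun y => u y ^ κ * T y * (pd i u y * pd j (pd j u) y)) x := fun i j =>
          (hi i j).sub (hi' i j)
        rw [integral_finsetSum _ fun i _ => integrable_finsetSum _ fun j _ => hs i j]
        refine Finset.sum_eq_zero fun i _ => ?_
        rw [integral_finsetSum _ fun j _ => hs i j]
        refine Finset.sum_eq_zero fun j _ => ?_
        rw [integral_sub (hi i j) (hi' i j), integral_pd_eq_zero (cV i j) (sV i j) j,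
          integral_pd_eq_zero (cW i j) (sW i j) i, sub_zero]

end Identities

section Mollification

variable {n : ℕ}

/-- The convolution of `f` with a normalized smooth bump. -/
noncomputable def mollify (b : ContDiffBump (0 : ESp n)) (f : ESp n → ℝ) : ESp n → ℝ :=
  convolution (b.normed volume) f (ContinuousLinearMap.lsmul ℝ ℝ) volume

lemma contDiff_mollify (b : ContDiffBump (0 : ESp n)) {f : ESp n → ℝ} (hf : Continuous f)
    {k : ℕ∞} : ContDiff ℝ k (mollify b f) :=
  b.hasCompactSupport_normed.contDiff_convolution_left _ b.contDiff_normed hf.locallyIntegrable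

lemma hasCompactSupport_mollify (b : ContDiffBump (0 : ESp n)) {f : ESp n → ℝ}
    (hc : HasCompactSupport f) : HasCompactSupport (mollify b f) :=
  b.hasCompactSupport_normed.convolution _ hc

lemma pd_mollify (b : ContDiffBump (0 : ESp n)) {f : ESp n → ℝ} (hf : ContDiff ℝ 1 f)
    (hc : HasCompactSupport f) (i : Fin n) : pd i (mollify b f) = mollify b (pd i f) := by
  funext x
  have hb : LocallyIntegrable (b.normed volume) (volume : Measure (ESp n)) :=
    (b.contDiff_normed (n := 0)).continuous.locallyIntegrable
  unfold pd mollify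
  rw [(hc.hasFDerivAt_convolution_right (ContinuousLinearMap.lsmul ℝ ℝ) hb hf x).fderiv,
    convolution_precompR_apply _ hb (hc.fderiv (𝕜 := ℝ)) (hf.continuous_fderiv (by norm_num))]

lemma lap_mollify (b : ContDiffBump (0 : ESp n)) {f : ESp n → ℝ} (hf : ContDiff ℝ 2 f)
    (hc : HasCompactSupport f) : lap (mollify b f) = mollify b (lap f) := by
  funext x
  have h1 : ContDiff ℝ 1 f := hf.of_le (by norm_num)
  have hp : ∀ i, ContDiff ℝ 1 (pd i f) := fun i => ContDiff.pd (k := 1) hf i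
  rw [lap_eq_sum (contDiff_mollify b hf.continuous (k := 2)),
    show lap f = fun x => ∑ i, pd i (pd i f) x from funext (lap_eq_sum hf)]
  simp_rw [pd_mollify b h1 hc, fun i => pd_mollify b (hp i) (hc.pd i) i]
  have hE : ∀ i, ConvolutionExistsAt (b.normed volume) (pd i (pd i f)) x
      (ContinuousLinearMap.lsmul ℝ ℝ) volume := fun i =>
    (b.hasCompactSupport_normed.convolutionExists_left _
      (b.contDiff_normed (n := 0)).continuous (continuous_pd (hp i) i).locallyIntegrable) x
  unfold mollify convolution
  rw [← integral_finsetSum _ fun i _ => (hE i).integrable]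
  refine integral_congr_ae (Filter.Eventually.of_forall fun t => ?_)
  simp

lemma abs_mollify_le (b : ContDiffBump (0 : ESp n)) {f : ESp n → ℝ} (hf : Continuous f)
    {M S : ℝ} (hM : ∀ x, |f x| ≤ M) (hS : ∀ x, S < ‖x‖ → f x = 0) (hb : b.rOut ≤ 1) (x : ESp n) :
    |mollify b f x| ≤ (Metric.closedBall (0 : ESp n) (S + 1)).indicator (fun _ => 3 * M) x := by
  have hdist : ∀ ε : ℝ, (∀ y ∈ Metric.ball x b.rOut, dist (f y) (f x) ≤ ε) →
      dist (mollify b f x) (f x) ≤ ε := fun ε h =>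
    ContDiffBump.dist_normed_convolution_le hf.aestronglyMeasurable h
  by_cases hx : x ∈ Metric.closedBall (0 : ESp n) (S + 1)
  · rw [Set.indicator_of_mem hx]
    have := hdist (2 * M) fun y _ => by
      rw [Real.dist_eq]
      exact (abs_sub _ _).trans (by linarith [hM y, hM x])
    rw [Real.dist_eq] at this
    have h3 := abs_sub_abs_le_abs_sub (mollify b f x) (f x)
    linarith [hM x]
  · rw [Set.indicator_of_notMem hx]
    rw [mem_closedBall_zero_iff, not_le] at hx
    have hfx : f x = 0 := hS x (by linarith)
    have := hdist 0 fun y hy => by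
      rw [hfx, hS y, dist_self]
      have h1 : ‖y - x‖ < 1 := by
        rw [← dist_eq_norm]; exact (Metric.mem_ball.1 hy).trans_le hb
      have h2 := norm_sub_norm_le x y
      rw [norm_sub_rev] at h2
      linarith
    rw [hfx, Real.dist_eq, sub_zero] at this
    exact this

/-- A quadratic inequality for smooth test functions extends to compactly supported `C²`
functions. -/
lemma integral_sq_le_integral_lap_sq {V : ESp n → ℝ} (hV : Continuous V) {p : ℝ}
    (h : ∀ φ : ESp n → ℝ, ContDiff ℝ (⊤ : ℕ∞) φ → HasCompactSupport φ →
      p * ∫ x, V x * φ x ^ 2 ≤ ∫ x, (lap φ x) ^ 2) {f : ESp n → ℝ} (hf : ContDiff ℝ 2 f)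
    (hc : HasCompactSupport f) : p * ∫ x, V x * f x ^ 2 ≤ ∫ x, (lap f x) ^ 2 := by
  have key : ∀ {W g : ESp n → ℝ}, Continuous W → Continuous g → HasCompactSupport g →
      ∀ b : ℕ → ContDiffBump (0 : ESp n), (∀ k, (b k).rOut ≤ 1) →
      Filter.Tendsto (fun k => (b k).rOut) Filter.atTop (nhds 0) →
      Filter.Tendsto (fun k => ∫ x, W x * mollify (b k) g x ^ 2) Filter.atTop
        (nhds (∫ x, W x * g x ^ 2)) := by
    intro W g hW hg hgc b hb1 hb
    obtain ⟨M, hM⟩ := hgc.exists_bound_of_continuous hg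
    obtain ⟨S, hS⟩ := hgc.isCompact.isBounded.subset_closedBall (0 : ESp n)
    have hS' : ∀ x, S < ‖x‖ → g x = 0 := fun x hx => by
      by_contra h0
      have := hS (subset_tsupport _ h0)
      rw [mem_closedBall_zero_iff] at this
      linarith
    refine tendsto_integral_of_dominated_convergence
      ((Metric.closedBall (0 : ESp n) (S + 1)).indicator fun x => |W x| * (3 * M) ^ 2) ?_ ?_ ?_ ?_
    · exact fun k =>
        (hW.mul ((contDiff_mollify (b k) hg (k := 0)).continuous.pow 2)).aestronglyMeasurable
    · rw [integrable_indicator_iff measurableSet_closedBall]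
      exact (hW.abs.mul continuous_const).continuousOn.integrableOn_compact
        (isCompact_closedBall _ _)
    · refine fun k => Filter.Eventually.of_forall fun x => ?_
      have := abs_mollify_le (b k) hg hM hS' (hb1 k) x
      rw [norm_mul, Real.norm_eq_abs, Real.norm_eq_abs, abs_pow]
      by_cases hx : x ∈ Metric.closedBall (0 : ESp n) (S + 1)
      · rw [Set.indicator_of_mem hx] at this ⊢
        gcongr
      · rw [Set.indicator_of_notMem hx] at this ⊢
        rw [le_antisymm this (abs_nonneg _)]
        simp
    · refine Filter.Eventually.of_forall fun x => ?_
      exact ((ContDiffBump.convolution_tendsto_right_of_continuous hb hg x).pow 2).const_mul _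
  let b : ℕ → ContDiffBump (0 : ESp n) := fun k =>
    ⟨1 / ((k : ℝ) + 2), 1 / ((k : ℝ) + 1), by positivity, by gcongr; norm_num⟩
  have hb1 : ∀ k, (b k).rOut ≤ 1 := fun k => by
    have : (0 : ℝ) ≤ k := k.cast_nonneg
    exact (div_le_one (by positivity)).2 (by linarith)
  have hb : Filter.Tendsto (fun k => (b k).rOut) Filter.atTop (nhds 0) :=
    tendsto_one_div_add_atTop_nhds_zero_nat
  have t1 := (key hV hf.continuous hc b hb1 hb).const_mul p
  have t2 := key (continuous_const (y := (1 : ℝ))) (continuous_lap hf) (hc.lap hf) b hb1 hb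
  simp only [one_mul] at t2
  refine le_of_tendsto_of_tendsto' t1 t2 fun k => ?_
  rw [← lap_mollify (b k) hf hc]
  exact h _ (contDiff_mollify _ hf.continuous) (hasCompactSupport_mollify _ hc)

end Mollification

section WeightedErrors

variable {n : ℕ}

/-- The weight `u ^ s * (1 - |x - x₀|² / R²)₊ ^ (2 m)`. -/
noncomputable def wt (u : ESp n → ℝ) (s : ℝ) (x₀ : ESp n) (m : ℕ) (R : ℝ) (x : ESp n) : ℝ :=
  u x ^ s * cut x₀ R (2 * m) x

/-- The energy density `u ^ (p + 1) + (Δu)² + |∇u|⁴ / u² + |D²u|²`. -/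
noncomputable def dens (u : ESp n → ℝ) (p : ℝ) (x : ESp n) : ℝ :=
  u x ^ (p + 1) + lap u x ^ 2 + (gradSq u x / u x) ^ 2 + hessSq u x

/-- The lower order quantity `u / (R² (1 - |x - x₀|² / R²)²)`. -/
noncomputable def rad (u : ESp n → ℝ) (x₀ : ESp n) (R : ℝ) (x : ESp n) : ℝ :=
  u x / (R ^ 2 * quadBump x₀ R x ^ 2)

/-- `c` is bounded by an arbitrarily small multiple of the energy density plus a multiple of the
square of the lower order quantity. -/
def Absorbable (u : ESp n → ℝ) (p : ℝ) (x₀ : ESp n) (c : ℝ → ESp n → ℝ) : Prop :=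
  ∀ ε > 0, ∃ C ≥ 0, ∀ R > 0, ∀ x, 0 < quadBump x₀ R x →
    |c R x| ≤ ε * dens u p x + C * rad u x₀ R x ^ 2

variable {u : ESp n → ℝ} {p : ℝ} {x₀ : ESp n} {c d : ℝ → ESp n → ℝ}

lemma dens_nonneg (hpos : ∀ x, 0 < u x) (x : ESp n) : 0 ≤ dens u p x := by
  have := hessSq_nonneg u x
  have := (rpow_pos_of_pos (hpos x) (p + 1)).le
  unfold dens
  positivity

lemma wt_nonneg (hpos : ∀ x, 0 < u x) (s : ℝ) (m : ℕ) (R : ℝ) (x : ESp n) :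
    0 ≤ wt u s x₀ m R x :=
  mul_nonneg (rpow_nonneg (hpos x).le _) (cut_nonneg _ _ _ _)

lemma continuous_rpow_of_pos (hu : Continuous u) (hpos : ∀ x, 0 < u x) (κ : ℝ) :
    Continuous fun x => u x ^ κ :=
  hu.rpow_const fun x => Or.inl (hpos x).ne'

lemma continuous_wt (hu : Continuous u) (hpos : ∀ x, 0 < u x) (s : ℝ) (m : ℕ) (R : ℝ) :
    Continuous (wt u s x₀ m R) :=
  (continuous_rpow_of_pos hu hpos s).mul (continuous_cut _ _ _)

lemma hasCompactSupport_wt (s : ℝ) {m : ℕ} (hm : m ≠ 0) {R : ℝ} (hR : 0 < R) :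
    HasCompactSupport (wt u s x₀ m R) :=
  (hasCompactSupport_cut x₀ hR (by omega)).mul_left

lemma continuous_dens (hu : ContDiff ℝ 2 u) (hpos : ∀ x, 0 < u x) : Continuous (dens u p) :=
  (((continuous_rpow_of_pos hu.continuous hpos _).add ((continuous_lap hu).pow 2)).add
    (((continuous_gradSq (hu.of_le (by norm_num))).div hu.continuous
      fun x => (hpos x).ne').pow 2)).add (continuous_hessSq hu)

lemma integrable_wt_mul (hu : Continuous u) (hpos : ∀ x, 0 < u x) (s : ℝ) {m : ℕ} (hm : m ≠ 0)
    {R : ℝ} (hR : 0 < R) {f : ESp n → ℝ} (hf : Continuous f) :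
    Integrable fun x => wt u s x₀ m R x * f x :=
  ((continuous_wt hu hpos s m R).mul hf).integrable_of_hasCompactSupport
    (hasCompactSupport_wt s hm hR).mul_right

lemma Absorbable.add (hc : Absorbable u p x₀ c) (hd : Absorbable u p x₀ d) :
    Absorbable u p x₀ fun R x => c R x + d R x := by
  intro ε hε
  obtain ⟨C, hC, h⟩ := hc (ε / 2) (by positivity)
  obtain ⟨D, hD, h'⟩ := hd (ε / 2) (by positivity)
  refine ⟨C + D, by positivity, fun R hR x hx => (abs_add_le _ _).trans ?_⟩
  have := h R hR x hx
  have := h' R hR x hx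
  linarith

lemma Absorbable.const_mul (hpos : ∀ x, 0 < u x) (hc : Absorbable u p x₀ c) (k : ℝ) :
    Absorbable u p x₀ fun R x => k * c R x := by
  intro ε hε
  obtain ⟨C, hC, h⟩ := hc (ε / (|k| + 1)) (by positivity)
  refine ⟨|k| * C, by positivity, fun R hR x hx => ?_⟩
  rw [abs_mul]
  have h0 := mul_nonneg hε.le (dens_nonneg (p := p) hpos x)
  calc |k| * |c R x| ≤ |k| * (ε / (|k| + 1) * dens u p x + C * rad u x₀ R x ^ 2) := by
        gcongr; exact h R hR x hx
    _ = ε * dens u p x * (|k| / (|k| + 1)) + |k| * C * rad u x₀ R x ^ 2 := by ring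
    _ ≤ ε * dens u p x * 1 + |k| * C * rad u x₀ R x ^ 2 := by
        gcongr
        exact (div_le_one (by positivity)).2 (by linarith)
    _ = _ := by ring

lemma Absorbable.mono (hc : Absorbable u p x₀ c)
    (h : ∀ R > 0, ∀ x, 0 < quadBump x₀ R x → |d R x| ≤ |c R x|) : Absorbable u p x₀ d := by
  intro ε hε
  obtain ⟨C, hC, h'⟩ := hc ε hε
  exact ⟨C, hC, fun R hR x hx => (h R hR x hx).trans (h' R hR x hx)⟩

lemma absorbable_of_le_sq {K : ℝ} (hpos : ∀ x, 0 < u x) (hK : 0 ≤ K)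
    (h : ∀ R > 0, ∀ x, 0 < quadBump x₀ R x → |c R x| ≤ K * rad u x₀ R x ^ 2) :
    Absorbable u p x₀ c := by
  intro ε hε
  refine ⟨K, hK, fun R hR x hx => (h R hR x hx).trans ?_⟩
  have := mul_nonneg hε.le (dens_nonneg (p := p) hpos x)
  linarith

lemma absorbable_of_sq_le_mul_sq {K : ℝ} (hpos : ∀ x, 0 < u x) (hK : 0 ≤ K)
    (h : ∀ R > 0, ∀ x, 0 < quadBump x₀ R x → c R x ^ 2 ≤ K * rad u x₀ R x ^ 2 * dens u p x) :
    Absorbable u p x₀ c := by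
  intro ε hε
  refine ⟨K / (4 * ε), by positivity, fun R hR x hx => ?_⟩
  have hd := dens_nonneg (p := p) hpos x
  refine abs_le_of_sq_le_sq ?_ (by positivity)
  refine (h R hR x hx).trans ?_
  have : K * rad u x₀ R x ^ 2 * dens u p x
      = 4 * (ε * dens u p x) * (K / (4 * ε) * rad u x₀ R x ^ 2) := by field_simp
  rw [this]
  nlinarith [sq_nonneg (ε * dens u p x - K / (4 * ε) * rad u x₀ R x ^ 2)]

lemma absorbable_of_sq_le_mul_grad {K : ℝ} (hpos : ∀ x, 0 < u x)
    (h : ∀ R > 0, ∀ x, 0 < quadBump x₀ R x →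
      c R x ^ 2 ≤ K * rad u x₀ R x * (gradSq u x / u x) * dens u p x) :
    Absorbable u p x₀ c := by
  intro ε hε
  refine ⟨K ^ 2 / (8 * ε ^ 3), by positivity, fun R hR x hx => ?_⟩
  have hd := dens_nonneg (p := p) hpos x
  refine abs_le_of_sq_le_sq ?_ (by positivity)
  refine (h R hR x hx).trans ?_
  set y := gradSq u x / u x
  set r := rad u x₀ R x
  have hy : y ^ 2 ≤ dens u p x := by
    have := hessSq_nonneg u x
    have := (rpow_pos_of_pos (hpos x) (p + 1)).le
    have := sq_nonneg (lap u x)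
    unfold dens
    linarith
  have h1 : K * r * y ≤ ε ^ 2 * y ^ 2 + 2 * ε * (K ^ 2 / (8 * ε ^ 3)) * r ^ 2 := by
    have : 2 * ε * (K ^ 2 / (8 * ε ^ 3)) * r ^ 2 = (K * r / (2 * ε)) ^ 2 := by
      field_simp; ring
    rw [this]
    have h2 : K * r * y = 2 * (ε * y) * (K * r / (2 * ε)) := by field_simp
    rw [h2]
    nlinarith [sq_nonneg (ε * y - K * r / (2 * ε))]
  have h3 : K * r * y ≤ ε ^ 2 * dens u p x + 2 * ε * (K ^ 2 / (8 * ε ^ 3)) * r ^ 2 :=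
    h1.trans (by gcongr)
  calc K * r * y * dens u p x
      ≤ (ε ^ 2 * dens u p x + 2 * ε * (K ^ 2 / (8 * ε ^ 3)) * r ^ 2) * dens u p x := by gcongr
    _ ≤ _ := by nlinarith [sq_nonneg (K ^ 2 / (8 * ε ^ 3) * r ^ 2)]

/-- The elementary inequality used to absorb the lower order terms. -/
lemma wt_mul_rad_sq_le {s : ℝ} {m : ℕ} (hpos : ∀ x, 0 < u x) (hp : 1 < p) (hs : 0 ≤ s + 2)
    (hm : 2 + 2 * ((s + 2) / (p - 1)) ≤ m) {ε : ℝ} (hε : 0 < ε) {R : ℝ} (hR : 0 < R) {x : ESp n}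
    (hx : 0 < quadBump x₀ R x) :
    wt u s x₀ m R x * rad u x₀ R x ^ 2 ≤ ε * (wt u s x₀ m R x * u x ^ (p + 1))
      + ε ^ (-((s + 2) / (p - 1))) * R ^ (-(4 + 4 * ((s + 2) / (p - 1)))) := by
  have hp' : 0 < p - 1 := by linarith
  set t := quadBump x₀ R x with ht
  set v := u x with hv
  have hv0 : 0 < v := hpos x
  set θ := (s + 2) / (p - 1) with hθ
  have hθ0 : 0 ≤ θ := by positivity
  have hw : wt u s x₀ m R x = v ^ s * t ^ (2 * m) := by
    unfold wt cut
    rw [posPow_of_nonneg _ hx.le]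
  have hw0 := wt_nonneg (x₀ := x₀) hpos s m R x
  have hC : 0 ≤ ε ^ (-θ) * R ^ (-(4 + 4 * θ)) := by positivity
  rcases le_or_gt 1 (v ^ (p - 1) * (ε * R ^ 4 * t ^ 4)) with h | h
  · have : rad u x₀ R x ^ 2 ≤ ε * u x ^ (p + 1) := by
      unfold rad
      rw [div_pow, div_le_iff₀ (by positivity)]
      have e : u x ^ (p + 1) = v ^ (p - 1) * v ^ 2 := by
        rw [← rpow_natCast, ← rpow_add hv0, ← hv]; norm_num; ring_nf
      rw [e]
      calc u x ^ 2 = 1 * v ^ 2 := by rw [one_mul]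
        _ ≤ v ^ (p - 1) * (ε * R ^ 4 * t ^ 4) * v ^ 2 := by gcongr
        _ = _ := by ring
    calc _ ≤ wt u s x₀ m R x * (ε * u x ^ (p + 1)) := by gcongr
      _ ≤ _ := by linarith
  · have h1 : v ^ (s + 2) ≤ (ε * R ^ 4 * t ^ 4) ^ (-θ) := by
      have h2 : v ^ (p - 1) ≤ (ε * R ^ 4 * t ^ 4)⁻¹ := by
        rw [← one_div, le_div_iff₀ (by positivity)]
        exact h.le
      have h3 := rpow_le_rpow (by positivity) h2 hθ0
      rw [← rpow_mul hv0.le, inv_rpow (by positivity), ← rpow_neg (by positivity)] at h3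
      rwa [hθ, mul_div_cancel₀ _ hp'.ne', ← hθ] at h3
    have h4 : (ε * R ^ 4 * t ^ 4) ^ (-θ) = ε ^ (-θ) * R ^ (-(4 * θ)) * t ^ (-(4 * θ)) := by
      rw [mul_rpow (by positivity) (by positivity), mul_rpow (by positivity) (by positivity),
        ← rpow_natCast, ← rpow_natCast, ← rpow_mul hR.le, ← rpow_mul hx.le]
      norm_num
    have h5 : wt u s x₀ m R x * rad u x₀ R x ^ 2
        = v ^ (s + 2) * R ^ (-(4 : ℝ)) * t ^ ((2 * m : ℝ) - 4) := by
      rw [hw, rad, ← ht, ← hv, rpow_sub hx, rpow_neg hR.le, rpow_add hv0]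
      norm_cast
      field_simp
    have h6 : t ^ (-(4 * θ)) * t ^ ((2 * m : ℝ) - 4) ≤ 1 := by
      rw [← rpow_add hx]
      exact rpow_le_one hx.le (quadBump_le_one _ _ _) (by linarith)
    have h7 : wt u s x₀ m R x * rad u x₀ R x ^ 2 ≤ ε ^ (-θ) * R ^ (-(4 + 4 * θ)) := by
      rw [h5]
      calc v ^ (s + 2) * R ^ (-(4 : ℝ)) * t ^ ((2 * m : ℝ) - 4)
          ≤ (ε ^ (-θ) * R ^ (-(4 * θ)) * t ^ (-(4 * θ))) * R ^ (-(4 : ℝ))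
            * t ^ ((2 * m : ℝ) - 4) := by
            rw [← h4]; gcongr
        _ = ε ^ (-θ) * (R ^ (-(4 * θ)) * R ^ (-(4 : ℝ)))
            * (t ^ (-(4 * θ)) * t ^ ((2 * m : ℝ) - 4)) := by
            ring
        _ ≤ ε ^ (-θ) * (R ^ (-(4 * θ)) * R ^ (-(4 : ℝ))) * 1 := by gcongr
        _ = _ := by rw [mul_one, ← rpow_add hR]; ring_nf
    have : 0 ≤ ε * (wt u s x₀ m R x * u x ^ (p + 1)) := by positivity
    linarith

/-- Integrals of absorbable terms are negligible. -/
lemma abs_integral_le_of_absorbable {s : ℝ} {m : ℕ} (hu : ContDiff ℝ 2 u) (hpos : ∀ x, 0 < u x)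
    (hp : 1 < p) (hs : 0 ≤ s + 2) (hm : 2 + 2 * ((s + 2) / (p - 1)) ≤ m)
    (hc : Absorbable u p x₀ c) {e : ℝ → ESp n → ℝ}
    (he : ∀ R > 0, ∀ x, 0 < quadBump x₀ R x → e R x = wt u s x₀ m R x * c R x)
    (he0 : ∀ R > 0, ∀ x, quadBump x₀ R x ≤ 0 → e R x = 0) :
    ∀ ε > 0, ∃ C ≥ 0, ∀ R > 0, |∫ x, e R x| ≤ ε * (∫ x, wt u s x₀ m R x * dens u p x)
      + C * R ^ ((n : ℝ) - (4 + 4 * ((s + 2) / (p - 1)))) := by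
  intro ε hε
  obtain ⟨C, hC, h⟩ := hc (ε / 2) (by positivity)
  set θ := (s + 2) / (p - 1) with hθ
  have hp' : 0 < p - 1 := by linarith
  have hθ0 : 0 ≤ θ := by positivity
  have hm0 : m ≠ 0 := by
    rintro rfl
    norm_num at hm
    linarith
  set ε' := ε / (2 * (C + 1)) with hε'
  have hε0 : 0 < ε' := by positivity
  set k := C * ε' ^ (-θ) with hk
  have hk0 : 0 ≤ k := by positivity
  refine ⟨k * volume.real (Metric.ball (0 : ESp n) 1), by positivity, fun R hR => ?_⟩
  have hd := fun x => dens_nonneg (p := p) hpos x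
  have hw := fun x => wt_nonneg (x₀ := x₀) hpos s m R x
  have hCε : C * ε' ≤ ε / 2 := by
    rw [hε', mul_div_assoc', div_le_div_iff₀ (by positivity) (by positivity)]
    nlinarith
  have hb : ∀ x, ‖e R x‖ ≤ ε * (wt u s x₀ m R x * dens u p x)
      + (Metric.closedBall x₀ R).indicator (fun _ => k * R ^ (-(4 + 4 * θ))) x := by
    intro x
    rcases le_or_gt (quadBump x₀ R x) 0 with hx | hx
    · rw [he0 R hR x hx, norm_zero]
      have h1 := mul_nonneg hε.le (mul_nonneg (hw x) (hd x))
      have h2 : 0 ≤ (Metric.closedBall x₀ R).indicator (fun _ => k * R ^ (-(4 + 4 * θ))) x :=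
        Set.indicator_nonneg (fun _ _ => by positivity) _
      linarith
    · have hxb : x ∈ Metric.closedBall x₀ R := by
        rw [Metric.mem_closedBall, dist_eq_norm]
        exact ((quadBump_pos_iff x₀ hR x).1 hx).le
      rw [Set.indicator_of_mem hxb, he R hR x hx, norm_mul, Real.norm_eq_abs, Real.norm_eq_abs,
        abs_of_nonneg (hw x)]
      have h1 := wt_mul_rad_sq_le hpos hp hs hm hε0 hR hx
      have h2 : u x ^ (p + 1) ≤ dens u p x := by
        have := hessSq_nonneg u x
        unfold dens
        nlinarith [sq_nonneg (lap u x), sq_nonneg (gradSq u x / u x)]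
      have h3 := mul_le_mul_of_nonneg_left h2 (hw x)
      calc wt u s x₀ m R x * |c R x|
          ≤ wt u s x₀ m R x * (ε / 2 * dens u p x + C * rad u x₀ R x ^ 2) := by
            gcongr
            · exact hw x
            · exact h R hR x hx
        _ = ε / 2 * (wt u s x₀ m R x * dens u p x) + C * (wt u s x₀ m R x * rad u x₀ R x ^ 2) := by
            ring
        _ ≤ ε / 2 * (wt u s x₀ m R x * dens u p x)
            + C * (ε' * (wt u s x₀ m R x * dens u p x) + ε' ^ (-θ) * R ^ (-(4 + 4 * θ))) := by
            gcongr
            exact h1.trans (by gcongr)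
        _ = (ε / 2 + C * ε') * (wt u s x₀ m R x * dens u p x) + k * R ^ (-(4 + 4 * θ)) := by
            rw [hk]; ring
        _ ≤ (ε / 2 + ε / 2) * (wt u s x₀ m R x * dens u p x) + k * R ^ (-(4 + 4 * θ)) := by
            gcongr
            exact mul_nonneg (hw x) (hd x)
        _ = _ := by ring
  have i1 : Integrable fun x => ε * (wt u s x₀ m R x * dens u p x) :=
    (integrable_wt_mul hu.continuous hpos s hm0 hR (continuous_dens hu hpos)).const_mul _
  have i2 : Integrable fun x =>
      (Metric.closedBall x₀ R).indicator (fun _ => k * R ^ (-(4 + 4 * θ))) x := by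
    rw [integrable_indicator_iff measurableSet_closedBall]
    exact continuousOn_const.integrableOn_compact (isCompact_closedBall _ _)
  refine (norm_integral_le_of_norm_le (i1.add i2) (Filter.Eventually.of_forall hb)).trans
    (le_of_eq ?_)
  simp only [Pi.add_apply]
  rw [integral_add i1 i2, integral_const_mul, integral_indicator measurableSet_closedBall,
    setIntegral_const, Measure.addHaar_real_closedBall _ _ hR.le, finrank_euclideanSpace_fin,
    smul_eq_mul, sub_eq_add_neg, rpow_add hR, rpow_natCast]
  ring

end WeightedErrors

section IntegralEstimates

variable {n : ℕ} {u : ESp n → ℝ} {p : ℝ} {x₀ : ESp n} {m : ℕ}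

lemma cut_of_nonpos {k : ℕ} (hk : k ≠ 0) {R : ℝ} {x : ESp n} (hx : quadBump x₀ R x ≤ 0) :
    cut x₀ R k x = 0 := posPow_of_nonpos hk hx

lemma cut_of_pos {k : ℕ} {R : ℝ} {x : ESp n} (hx : 0 < quadBump x₀ R x) :
    cut x₀ R k x = quadBump x₀ R x ^ k := posPow_of_nonneg _ hx.le

lemma gradDot_cut {k : ℕ} (hk : 1 ≤ k) (R : ℝ) (x : ESp n) :
    gradDot u (cut x₀ R (k + 1)) x = (k + 1) * cut x₀ R k x * gradDot u (quadBump x₀ R) x := by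
  unfold gradDot
  rw [Finset.mul_sum]
  refine Finset.sum_congr rfl fun i _ => ?_
  rw [pd_cut x₀ R hk]; ring

lemma hessDot_cut {k : ℕ} (hk : 1 ≤ k) (R : ℝ) (x : ESp n) :
    hessDot u (cut x₀ R (k + 1)) x = (k + 1) * cut x₀ R k x * hessDot u (quadBump x₀ R) x := by
  unfold hessDot
  simp only [Finset.mul_sum]
  refine Finset.sum_congr rfl fun i _ => Finset.sum_congr rfl fun j _ => ?_
  rw [pd_cut x₀ R hk]; ring

lemma lap_cut_of_nonpos {k : ℕ} (hk : 1 ≤ k) {R : ℝ} (hR : 0 < R) {x : ESp n}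
    (hx : quadBump x₀ R x ≤ 0) : lap (cut x₀ R (k + 2)) x = 0 := by
  have := abs_lap_cut_le x₀ hR hk x
  rw [cut_of_nonpos (by omega) hx] at this
  simpa using this

lemma sq_gradDot_div_le (hpos : ∀ x, 0 < u x) {R : ℝ} (hR : 0 < R) {x : ESp n}
    (hx : 0 < quadBump x₀ R x) :
    (gradDot u (quadBump x₀ R) x / quadBump x₀ R x) ^ 2
      ≤ 4 * rad u x₀ R x * (gradSq u x / u x) := by
  have h := (gradDot_sq_le u (quadBump x₀ R) x).trans
    (mul_le_mul_of_nonneg_left (sum_pd_quadBump_sq_le x₀ hR hx) (gradSq_nonneg u x))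
  have hu := hpos x
  rw [div_pow, div_le_iff₀ (by positivity)]
  refine h.trans (le_of_eq ?_)
  unfold rad
  field_simp

lemma sq_hessDot_div_le (hpos : ∀ x, 0 < u x) {R : ℝ} (hR : 0 < R) {x : ESp n}
    (hx : 0 < quadBump x₀ R x) :
    (hessDot u (quadBump x₀ R) x / quadBump x₀ R x) ^ 2
      ≤ 4 * rad u x₀ R x * (gradSq u x / u x) * hessSq u x := by
  have h := (hessDot_sq_le u (quadBump x₀ R) x).trans (mul_le_mul_of_nonneg_right
    (mul_le_mul_of_nonneg_left (sum_pd_quadBump_sq_le x₀ hR hx) (gradSq_nonneg u x))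
    (hessSq_nonneg u x))
  have hu := hpos x
  rw [div_pow, div_le_iff₀ (by positivity)]
  refine h.trans (le_of_eq ?_)
  unfold rad
  field_simp

lemma rad_nonneg (hpos : ∀ x, 0 < u x) (R : ℝ) (x : ESp n) : 0 ≤ rad u x₀ R x := by
  have := hpos x
  unfold rad
  positivity

lemma div_nonneg_gradSq (hpos : ∀ x, 0 < u x) (x : ESp n) : 0 ≤ gradSq u x / u x :=
  div_nonneg (gradSq_nonneg u x) (hpos x).le

lemma absorbable_gradDot_mul (hpos : ∀ x, 0 < u x) {S : ESp n → ℝ}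
    (hS : ∀ x, S x ^ 2 ≤ dens u p x) :
    Absorbable u p x₀ fun R x => gradDot u (quadBump x₀ R) x / quadBump x₀ R x * S x := by
  refine absorbable_of_sq_le_mul_grad (K := 4) hpos fun R hR x hx => ?_
  rw [mul_pow]
  have := rad_nonneg (x₀ := x₀) hpos R x
  have := div_nonneg_gradSq hpos x
  exact mul_le_mul (sq_gradDot_div_le hpos hR hx) (hS x) (sq_nonneg _) (by positivity)

lemma absorbable_hessDot (hpos : ∀ x, 0 < u x) :
    Absorbable u p x₀ fun R x => hessDot u (quadBump x₀ R) x / quadBump x₀ R x := by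
  refine absorbable_of_sq_le_mul_grad (K := 4) hpos fun R hR x hx => ?_
  refine (sq_hessDot_div_le hpos hR hx).trans ?_
  have := rad_nonneg (x₀ := x₀) hpos R x
  have := div_nonneg_gradSq hpos x
  gcongr
  have := (rpow_pos_of_pos (hpos x) (p + 1)).le
  unfold dens
  nlinarith [sq_nonneg (lap u x), sq_nonneg (gradSq u x / u x)]

lemma sq_grad_le_dens (hpos : ∀ x, 0 < u x) (x : ESp n) : (gradSq u x / u x) ^ 2 ≤ dens u p x := by
  have := (rpow_pos_of_pos (hpos x) (p + 1)).le
  have := hessSq_nonneg u x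
  unfold dens
  nlinarith [sq_nonneg (lap u x)]

lemma sq_lap_le_dens (hpos : ∀ x, 0 < u x) (x : ESp n) : lap u x ^ 2 ≤ dens u p x := by
  have := (rpow_pos_of_pos (hpos x) (p + 1)).le
  have := hessSq_nonneg u x
  unfold dens
  nlinarith [sq_nonneg (gradSq u x / u x)]

lemma sq_rpow_le_dens (hpos : ∀ x, 0 < u x) (x : ESp n) :
    (u x ^ ((p + 1) / 2)) ^ 2 ≤ dens u p x := by
  have e : (u x ^ ((p + 1) / 2)) ^ 2 = u x ^ (p + 1) := by
    rw [← rpow_natCast, ← rpow_mul (hpos x).le]; norm_num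
  have := hessSq_nonneg u x
  rw [e]
  unfold dens
  nlinarith [sq_nonneg (gradSq u x / u x), sq_nonneg (lap u x)]

lemma absorbable_sq_gradDot (hpos : ∀ x, 0 < u x) :
    Absorbable u p x₀ fun R x => (gradDot u (quadBump x₀ R) x / quadBump x₀ R x) ^ 2 := by
  refine absorbable_of_sq_le_mul_sq (K := 16) hpos (by norm_num) fun R hR x hx => ?_
  have := rad_nonneg (x₀ := x₀) hpos R x
  have := div_nonneg_gradSq hpos x
  calc _ ≤ (4 * rad u x₀ R x * (gradSq u x / u x)) ^ 2 := by
        gcongr; exact sq_gradDot_div_le hpos hR hx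
    _ = 16 * rad u x₀ R x ^ 2 * (gradSq u x / u x) ^ 2 := by ring
    _ ≤ _ := by gcongr; exact sq_grad_le_dens hpos x

lemma abs_mul_lap_cut_div_le (hpos : ∀ x, 0 < u x) {k : ℕ} (hk : 1 ≤ k) {R : ℝ} (hR : 0 < R)
    {x : ESp n} (hx : 0 < quadBump x₀ R x) :
    |u x * lap (cut x₀ R (k + 2)) x / quadBump x₀ R x ^ (k + 2)|
      ≤ ((k + 2) * (k + 1) * 4 + 2 * n * (k + 2)) * rad u x₀ R x := by
  have h := abs_lap_cut_le x₀ hR hk x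
  have hu := hpos x
  rw [cut_of_pos hx] at h
  rw [abs_div, abs_mul, abs_of_pos hu, abs_of_pos (pow_pos hx _), div_le_iff₀ (by positivity)]
  refine (mul_le_mul_of_nonneg_left h hu.le).trans (le_of_eq ?_)
  unfold rad
  rw [pow_add]
  field_simp

lemma absorbable_mul_lap_cut (hpos : ∀ x, 0 < u x) {k : ℕ} (hk : 1 ≤ k) {S : ESp n → ℝ}
    (hS : ∀ x, S x ^ 2 ≤ dens u p x) :
    Absorbable u p x₀ fun R x =>
      u x * lap (cut x₀ R (k + 2)) x / quadBump x₀ R x ^ (k + 2) * S x := by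
  refine absorbable_of_sq_le_mul_sq (K := ((k + 2) * (k + 1) * 4 + 2 * n * (k + 2)) ^ 2) hpos
    (by positivity) fun R hR x hx => ?_
  rw [mul_pow, ← mul_pow (_ + _), ← sq_abs (_ / _)]
  gcongr
  · exact abs_mul_lap_cut_div_le hpos hk hR hx
  · exact hS x

lemma absorbable_sq_lap_cut (hpos : ∀ x, 0 < u x) {k : ℕ} (hk : 1 ≤ k) :
    Absorbable u p x₀ fun R x =>
      (u x * lap (cut x₀ R (k + 2)) x / quadBump x₀ R x ^ (k + 2)) ^ 2 := by
  refine absorbable_of_le_sq (K := ((k + 2) * (k + 1) * 4 + 2 * n * (k + 2)) ^ 2) hpos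
    (by positivity) fun R hR x hx => ?_
  rw [abs_of_nonneg (sq_nonneg _), ← mul_pow, ← sq_abs (_ / _)]
  gcongr
  exact abs_mul_lap_cut_div_le hpos hk hR hx

/-- The weighted integral of `f`. -/
noncomputable def wInt (u : ESp n → ℝ) (s : ℝ) (x₀ : ESp n) (m : ℕ) (R : ℝ) (f : ESp n → ℝ) : ℝ :=
  ∫ x, wt u s x₀ m R x * f x

section

variable {s R : ℝ} {f g : ESp n → ℝ}

lemma wInt_add (hu : Continuous u) (hpos : ∀ x, 0 < u x) (hm : m ≠ 0) (hR : 0 < R)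
    (hf : Continuous f) (hg : Continuous g) :
    wInt u s x₀ m R (fun x => f x + g x) = wInt u s x₀ m R f + wInt u s x₀ m R g := by
  unfold wInt
  rw [← integral_add (integrable_wt_mul hu hpos s hm hR hf) (integrable_wt_mul hu hpos s hm hR hg)]
  simp only [mul_add]

lemma wInt_const_mul (k : ℝ) :
    wInt u s x₀ m R (fun x => k * f x) = k * wInt u s x₀ m R f := by
  unfold wInt
  rw [← integral_const_mul]
  simp only [mul_left_comm]

lemma wInt_mono (hu : Continuous u) (hpos : ∀ x, 0 < u x) (hm : m ≠ 0) (hR : 0 < R)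
    (hf : Continuous f) (hg : Continuous g) (h : ∀ x, f x ≤ g x) :
    wInt u s x₀ m R f ≤ wInt u s x₀ m R g :=
  integral_mono (integrable_wt_mul hu hpos s hm hR hf) (integrable_wt_mul hu hpos s hm hR hg)
    fun x => mul_le_mul_of_nonneg_left (h x) (wt_nonneg hpos s m R x)

lemma wInt_nonneg (hpos : ∀ x, 0 < u x) (h : ∀ x, 0 ≤ f x) : 0 ≤ wInt u s x₀ m R f :=
  integral_nonneg fun x => mul_nonneg (wt_nonneg hpos s m R x) (h x)

end

lemma continuous_grad_div (hu : ContDiff ℝ 1 u) (hpos : ∀ x, 0 < u x) :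
    Continuous fun x => gradSq u x / u x :=
  (continuous_gradSq hu).div hu.continuous fun x => (hpos x).ne'

lemma continuous_hessGrad_div (hu : ContDiff ℝ 2 u) (hpos : ∀ x, 0 < u x) :
    Continuous fun x => hessGrad u x / u x :=
  (continuous_hessGrad hu).div hu.continuous fun x => (hpos x).ne'

/-- `F R` is a negligible boundary contribution. -/
def Negligible (u : ESp n → ℝ) (p s : ℝ) (x₀ : ESp n) (m : ℕ) (F : ℝ → ℝ) : Prop :=
  ∀ ε > 0, ∃ C ≥ 0, ∀ R > 0, |F R| ≤ ε * wInt u s x₀ m R (dens u p)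
    + C * R ^ ((n : ℝ) - (4 + 4 * ((s + 2) / (p - 1))))

lemma three_le_of_bound {s : ℝ} (hp : 1 < p) (hs : 0 ≤ s)
    (hm : 2 + 2 * ((s + 2) / (p - 1)) ≤ m) : 3 ≤ m := by
  have : 0 < (s + 2) / (p - 1) := by apply div_pos <;> linarith
  have : (2 : ℝ) < m := by linarith
  exact_mod_cast this

lemma wt_of_nonpos {s : ℝ} (hm : m ≠ 0) {R : ℝ} {x : ESp n} (hx : quadBump x₀ R x ≤ 0) :
    wt u s x₀ m R x = 0 := by
  rw [wt, cut_of_nonpos (by omega) hx, mul_zero]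

lemma wt_of_pos {s : ℝ} {R : ℝ} {x : ESp n} (hx : 0 < quadBump x₀ R x) :
    wt u s x₀ m R x = u x ^ s * quadBump x₀ R x ^ (2 * m) := by
  rw [wt, cut_of_pos hx]

lemma negligible_of_integral_eq {s : ℝ} (hu : ContDiff ℝ 4 u) (hpos : ∀ x, 0 < u x) (hp : 1 < p)
    (hs : 0 ≤ s) (hm : 2 + 2 * ((s + 2) / (p - 1)) ≤ m) {f : ESp n → ℝ} (hf : Continuous f)
    {c e : ℝ → ESp n → ℝ} (hc : Absorbable u p x₀ c)
    (he : ∀ R > 0, ∀ x, 0 < quadBump x₀ R x → e R x = wt u s x₀ m R x * c R x)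
    (he0 : ∀ R > 0, ∀ x, quadBump x₀ R x ≤ 0 → e R x = 0) (hec : ∀ R > 0, Continuous (e R))
    (h0 : ∀ R > 0, ∫ x, (wt u s x₀ m R x * f x - e R x) = 0) :
    Negligible u p s x₀ m fun R => wInt u s x₀ m R f := by
  have hm3 := three_le_of_bound hp hs hm
  intro ε hε
  obtain ⟨C, hC, h⟩ := abs_integral_le_of_absorbable (hu.of_le (by norm_num)) hpos hp
    (by linarith) hm hc he he0 ε hε
  refine ⟨C, hC, fun R hR => le_trans (le_of_eq ?_) (h R hR)⟩
  have i1 := integrable_wt_mul (x₀ := x₀) hu.continuous hpos s (m := m) (by omega) hR hf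
  have i2 : Integrable (e R) := by
    refine (hec R hR).integrable_of_hasCompactSupport
      (HasCompactSupport.intro (isCompact_closedBall x₀ R) fun x hx => he0 R hR x ?_)
    rw [Metric.mem_closedBall, dist_eq_norm] at hx
    rw [← not_lt, quadBump_pos_iff x₀ hR]
    linarith
  have h1 := h0 R hR
  rw [integral_sub i1 i2, sub_eq_zero] at h1
  simp only [wInt]
  rw [h1]

/-- The integrated Bochner identity. -/
lemma negligible_hess {s : ℝ} (hu : ContDiff ℝ 4 u) (hpos : ∀ x, 0 < u x) (hp : 1 < p)
    (hs : 0 ≤ s) (hm : 2 + 2 * ((s + 2) / (p - 1)) ≤ m) :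
    Negligible u p s x₀ m fun R => wInt u s x₀ m R (fun x => hessSq u x - lap u x ^ 2
      + s * (hessGrad u x / u x) - s * (lap u x * (gradSq u x / u x))) := by
  have hm3 := three_le_of_bound hp hs hm
  obtain ⟨l, rfl⟩ : ∃ l, m = l + 2 := ⟨m - 2, by omega⟩
  have hu2 : ContDiff ℝ 2 u := hu.of_le (by norm_num)
  have hu1 : ContDiff ℝ 1 u := hu.of_le (by norm_num)
  have hT : ∀ R, ContDiff ℝ 1 (cut x₀ R (2 * (l + 2))) := fun R =>
    contDiff_cut x₀ R (k := 1) (by omega)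
  refine negligible_of_integral_eq hu hpos hp hs hm
    ((((continuous_hessSq hu2).sub ((continuous_lap hu2).pow 2)).add
          (continuous_const.mul (continuous_hessGrad_div hu2 hpos))).sub
          (continuous_const.mul ((continuous_lap hu2).mul (continuous_grad_div hu1 hpos))))
    (((absorbable_hessDot hpos).const_mul hpos (-(2 * l + 4) : ℝ)).add
      ((absorbable_gradDot_mul hpos (sq_lap_le_dens hpos)).const_mul hpos (2 * l + 4 : ℝ)))
    (e := fun R x => -(u x ^ s * (hessDot u (cut x₀ R (2 * (l + 2))) x
      - gradDot u (cut x₀ R (2 * (l + 2))) x * lap u x))) (fun R hR x hx => ?_)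
    (fun R hR x hx => ?_) (fun R hR => ?_) fun R hR => ?_
  · rw [show 2 * (l + 2) = (2 * l + 3) + 1 by ring, hessDot_cut (by omega),
      gradDot_cut (by omega), wt_of_pos hx, cut_of_pos hx]
    push_cast
    field_simp
    ring
  · rw [show 2 * (l + 2) = (2 * l + 3) + 1 by ring, hessDot_cut (by omega),
      gradDot_cut (by omega), cut_of_nonpos (by omega) hx]
    simp
  · exact ((continuous_rpow_of_pos hu.continuous hpos s).mul ((continuous_hessDot hu2 (hT R)).sub
      ((continuous_gradDot hu1 (hT R)).mul (continuous_lap hu2)))).neg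
  · rw [← integral_div_rpow_hess (hu.of_le (by norm_num)) hpos (hT R)
      (hasCompactSupport_cut x₀ hR (m := 2 * (l + 2)) (by omega)) s]
    refine integral_congr_ae (Filter.Eventually.of_forall fun x => ?_)
    have := hpos x
    simp only [wt]
    rw [rpow_sub_one this.ne']
    field_simp
    ring

lemma negligible_gradSq {s : ℝ} (hu : ContDiff ℝ 4 u) (hpos : ∀ x, 0 < u x) (hp : 1 < p)
    (hs : 0 ≤ s) (hm : 2 + 2 * ((s + 2) / (p - 1)) ≤ m) :
    Negligible u p s x₀ m fun R => wInt u s x₀ m R (fun x => (s - 1) * (gradSq u x / u x) ^ 2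
      + 2 * (hessGrad u x / u x) + lap u x * (gradSq u x / u x)) := by
  have hm3 := three_le_of_bound hp hs hm
  obtain ⟨l, rfl⟩ : ∃ l, m = l + 2 := ⟨m - 2, by omega⟩
  have hu2 : ContDiff ℝ 2 u := hu.of_le (by norm_num)
  have hu1 : ContDiff ℝ 1 u := hu.of_le (by norm_num)
  have hT : ∀ R, ContDiff ℝ 1 (cut x₀ R (2 * (l + 2))) := fun R =>
    contDiff_cut x₀ R (k := 1) (by omega)
  refine negligible_of_integral_eq hu hpos hp hs hm
    (((continuous_const.mul ((continuous_grad_div hu1 hpos).pow 2)).add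
          (continuous_const.mul (continuous_hessGrad_div hu2 hpos))).add
          ((continuous_lap hu2).mul (continuous_grad_div hu1 hpos)))
    ((absorbable_gradDot_mul hpos (sq_grad_le_dens hpos)).const_mul hpos (-(2 * l + 4) : ℝ))
    (e := fun R x => -(u x ^ (s - 1) * gradSq u x * gradDot u (cut x₀ R (2 * (l + 2))) x))
    (fun R hR x hx => ?_)
    (fun R hR x hx => ?_) (fun R hR => ?_) fun R hR => ?_
  · rw [show 2 * (l + 2) = (2 * l + 3) + 1 by ring,
      gradDot_cut (by omega), wt_of_pos hx, cut_of_pos hx, rpow_sub_one (hpos x).ne']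
    have := hpos x
    push_cast
    field_simp
    ring
  · rw [show 2 * (l + 2) = (2 * l + 3) + 1 by ring,
      gradDot_cut (by omega), cut_of_nonpos (by omega) hx]
    simp
  · exact (((continuous_rpow_of_pos hu.continuous hpos _).mul (continuous_gradSq hu1)).mul
      (continuous_gradDot hu1 (hT R))).neg
  · rw [← integral_div_rpow_gradSq hu2 hpos (hT R)
      (hasCompactSupport_cut x₀ hR (m := 2 * (l + 2)) (by omega)) (s - 1)]
    refine integral_congr_ae (Filter.Eventually.of_forall fun x => ?_)
    have := hpos x
    simp only [wt]
    rw [rpow_sub_one this.ne' (s - 1), rpow_sub_one this.ne' s]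
    field_simp
    ring

lemma negligible_grad {s : ℝ} (hu : ContDiff ℝ 4 u) (hpos : ∀ x, 0 < u x) (hp : 1 < p)
    (hs : 0 ≤ s) (hm : 2 + 2 * ((s + 2) / (p - 1)) ≤ m) :
    Negligible u p s x₀ m fun R => wInt u s x₀ m R (fun x => u x ^ ((p + 1) / 2) * lap u x
      + (s + (p + 1) / 2) * (u x ^ ((p + 1) / 2) * (gradSq u x / u x))) := by
  have hm3 := three_le_of_bound hp hs hm
  obtain ⟨l, rfl⟩ : ∃ l, m = l + 2 := ⟨m - 2, by omega⟩
  have hu2 : ContDiff ℝ 2 u := hu.of_le (by norm_num)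
  have hu1 : ContDiff ℝ 1 u := hu.of_le (by norm_num)
  have hT : ∀ R, ContDiff ℝ 1 (cut x₀ R (2 * (l + 2))) := fun R =>
    contDiff_cut x₀ R (k := 1) (by omega)
  have hz := continuous_rpow_of_pos hu.continuous hpos ((p + 1) / 2)
  refine negligible_of_integral_eq hu hpos hp hs hm
    ((hz.mul (continuous_lap hu2)).add
      (continuous_const.mul (hz.mul (continuous_grad_div hu1 hpos))))
    ((absorbable_gradDot_mul hpos (sq_rpow_le_dens hpos)).const_mul hpos (-(2 * l + 4) : ℝ))
    (e := fun R x => -(u x ^ (s + (p + 1) / 2) * gradDot u (cut x₀ R (2 * (l + 2))) x))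
    (fun R hR x hx => ?_)
    (fun R hR x hx => ?_) (fun R hR => ?_) fun R hR => ?_
  · rw [show 2 * (l + 2) = (2 * l + 3) + 1 by ring,
      gradDot_cut (by omega), wt_of_pos hx, cut_of_pos hx, rpow_add (hpos x)]
    have := hpos x
    push_cast
    field_simp
    ring
  · rw [show 2 * (l + 2) = (2 * l + 3) + 1 by ring,
      gradDot_cut (by omega), cut_of_nonpos (by omega) hx]
    simp
  · exact ((continuous_rpow_of_pos hu.continuous hpos _).mul (continuous_gradDot hu1 (hT R))).neg
  · rw [← integral_div_rpow_grad hu2 hpos (hT R)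
      (hasCompactSupport_cut x₀ hR (m := 2 * (l + 2)) (by omega)) (s + (p + 1) / 2)]
    refine integral_congr_ae (Filter.Eventually.of_forall fun x => ?_)
    have := hpos x
    simp only [wt]
    rw [rpow_sub_one this.ne', rpow_add this]
    field_simp
    ring

/-- The equation tested against `u ^ (s + 1)`. -/
lemma negligible_equation {s : ℝ} (hu : ContDiff ℝ 4 u) (hpos : ∀ x, 0 < u x) (hp : 1 < p)
    (hs : 0 ≤ s) (hm : 2 + 2 * ((s + 2) / (p - 1)) ≤ m)
    (heq : ∀ x, lap (lap u) x = u x ^ p) :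
    Negligible u p s x₀ m fun R => wInt u s x₀ m R (fun x => u x ^ (p + 1)
      - (s + 1) * lap u x ^ 2 - s * (s + 1) * (lap u x * (gradSq u x / u x))) := by
  have hm3 := three_le_of_bound hp hs hm
  obtain ⟨l, rfl⟩ : ∃ l, m = l + 2 := ⟨m - 2, by omega⟩
  have hu2 : ContDiff ℝ 2 u := hu.of_le (by norm_num)
  have hu1 : ContDiff ℝ 1 u := hu.of_le (by norm_num)
  have hL : ContDiff ℝ 2 (lap u) := ContDiff.lap_cd (k := 2) hu
  have hT : ∀ R, ContDiff ℝ 2 (cut x₀ R (2 * (l + 2))) := fun R =>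
    contDiff_cut x₀ R (k := 2) (by omega)
  have hg : ∀ R, ContDiff ℝ 2 fun x => u x ^ (s + 1) * cut x₀ R (2 * (l + 2)) x := fun R =>
    (hu2.rpow_const_of_ne fun x => (hpos x).ne').mul (hT R)
  have hk : 2 * (l + 2) = (2 * l + 2) + 2 := by ring
  refine negligible_of_integral_eq hu hpos hp hs hm
    (((continuous_rpow_of_pos hu.continuous hpos _).sub
      (continuous_const.mul ((continuous_lap hu2).pow 2))).sub
          (continuous_const.mul ((continuous_lap hu2).mul (continuous_grad_div hu1 hpos))))
    (((absorbable_gradDot_mul hpos (sq_lap_le_dens hpos)).const_mul hpos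
      (2 * (s + 1) * (2 * l + 4))).add
      (absorbable_mul_lap_cut hpos (k := 2 * l + 2) (by omega) (sq_lap_le_dens hpos)))
    (e := fun R x => lap u x * (2 * (s + 1) * u x ^ s * gradDot u (cut x₀ R (2 * (l + 2))) x
      + u x ^ (s + 1) * lap (cut x₀ R (2 * (l + 2))) x))
    (fun R hR x hx => ?_)
    (fun R hR x hx => ?_) (fun R hR => ?_) fun R hR => ?_
  · rw [← hk, show 2 * (l + 2) = (2 * l + 3) + 1 by ring,
      gradDot_cut (by omega), wt_of_pos hx, cut_of_pos hx, rpow_add_one (hpos x).ne']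
    have := hpos x
    push_cast
    field_simp
    ring
  · rw [hk, lap_cut_of_nonpos (by omega) hR hx, show 2 * l + 2 + 2 = (2 * l + 3) + 1 by ring,
      gradDot_cut (by omega), cut_of_nonpos (by omega) hx]
    simp
  · exact (continuous_lap hu2).mul (((continuous_const.mul
      (continuous_rpow_of_pos hu.continuous hpos _)).mul
        (continuous_gradDot hu1 ((hT R).of_le (by norm_num)))).add
        ((continuous_rpow_of_pos hu.continuous hpos _).mul (continuous_lap (hT R))))
  · have hc : HasCompactSupport fun x => u x ^ (s + 1) * cut x₀ R (2 * (l + 2)) x :=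
      (hasCompactSupport_cut x₀ hR (m := 2 * (l + 2)) (by omega)).mul_left
    have h1 := integral_mul_lap hL (hg R) hc
    have i1 : Integrable fun x => lap (lap u) x * (u x ^ (s + 1) * cut x₀ R (2 * (l + 2)) x) :=
      ((continuous_lap hL).mul (hg R).continuous).integrable_of_hasCompactSupport hc.mul_left
    have i2 : Integrable fun x => lap u x *
        lap (fun x => u x ^ (s + 1) * cut x₀ R (2 * (l + 2)) x) x :=
      (hL.continuous.mul (continuous_lap (hg R))).integrable_of_hasCompactSupport
        (hc.lap (hg R)).mul_left
    rw [← sub_eq_zero, ← integral_sub i1 i2] at h1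
    rw [← h1]
    refine integral_congr_ae (Filter.Eventually.of_forall fun x => ?_)
    have := hpos x
    simp only [wt]
    rw [heq, lap_rpow_mul hu2 hpos (hT R), show s + 1 - 1 = s by ring,
      show s + 1 - 2 = s - 1 by ring, rpow_sub_one this.ne' s, rpow_add_one this.ne' p,
      rpow_add_one this.ne' s]
    field_simp
    ring

end IntegralEstimates

section Stability

variable {n : ℕ} {u : ESp n → ℝ} {p : ℝ} {x₀ : ESp n} {m : ℕ}

/-- The stability inequality tested against `u ^ (s / 2 + 1)`. -/
lemma negligible_stability {s : ℝ} (hu : ContDiff ℝ 4 u) (hpos : ∀ x, 0 < u x) (hp : 1 < p)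
    (hs : 0 ≤ s) (hm : 2 + 2 * ((s + 2) / (p - 1)) ≤ m)
    (hstab : ∀ φ : ESp n → ℝ, ContDiff ℝ (⊤ : ℕ∞) φ → HasCompactSupport φ →
      p * ∫ x, u x ^ (p - 1) * φ x ^ 2 ≤ ∫ x, (lap φ x) ^ 2) :
    ∃ F, Negligible u p s x₀ m F ∧ ∀ R > 0, p * wInt u s x₀ m R (fun x => u x ^ (p + 1)) ≤
      wInt u s x₀ m R (fun x => (s / 2 + 1) ^ 2 * (lap u x ^ 2
        + s * (lap u x * (gradSq u x / u x)) + s ^ 2 / 4 * (gradSq u x / u x) ^ 2)) + F R := by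
  have hm3 := three_le_of_bound hp hs hm
  obtain ⟨l, rfl⟩ : ∃ l, m = l + 2 := ⟨m - 2, by omega⟩
  have hu2 : ContDiff ℝ 2 u := hu.of_le (by norm_num)
  have hu1 : ContDiff ℝ 1 u := hu.of_le (by norm_num)
  have hT : ∀ R, ContDiff ℝ 2 (cut x₀ R (l + 2)) := fun R =>
    contDiff_cut x₀ R (k := 2) (by omega)
  have hg : ∀ R, ContDiff ℝ 2 fun x => u x ^ (s / 2 + 1) * cut x₀ R (l + 2) x := fun R =>
    (hu2.rpow_const_of_ne fun x => (hpos x).ne').mul (hT R)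
  have hf : Continuous fun x => (s / 2 + 1) ^ 2 * (lap u x ^ 2
        + s * (lap u x * (gradSq u x / u x)) + s ^ 2 / 4 * (gradSq u x / u x) ^ 2) :=
    continuous_const.mul ((((continuous_lap hu2).pow 2).add
      (continuous_const.mul ((continuous_lap hu2).mul (continuous_grad_div hu1 hpos)))).add
      (continuous_const.mul ((continuous_grad_div hu1 hpos).pow 2)))
  have hl : 1 ≤ l := by omega
  set M : ℝ := 2 * (s / 2 + 1) * (l + 2) with hM
  have hP : ∀ x, u x ^ s = (u x ^ (s / 2)) ^ 2 := fun x => by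
    rw [← rpow_natCast, ← rpow_mul (hpos x).le]
    norm_num
  have hlap : ∀ R x, lap (fun x => u x ^ (s / 2 + 1) * cut x₀ R (l + 2) x) x =
      u x ^ (s / 2) * ((s / 2 + 1) * (lap u x + s / 2 * (gradSq u x / u x)) * cut x₀ R (l + 2) x
        + M * cut x₀ R (l + 1) x * gradDot u (quadBump x₀ R) x
        + u x * lap (cut x₀ R (l + 2)) x) := by
    intro R x
    have := hpos x
    rw [lap_rpow_mul hu2 hpos (hT R), show s / 2 + 1 - 1 = s / 2 by ring,
      show s / 2 + 1 - 2 = s / 2 - 1 by ring, rpow_sub_one this.ne', rpow_add_one this.ne',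
      gradDot_cut (k := l + 1) (by omega), hM]
    push_cast
    field_simp
    ring
  have hsq : Absorbable u p x₀ fun R x => (M * (gradDot u (quadBump x₀ R) x / quadBump x₀ R x)
      + u x * lap (cut x₀ R (l + 2)) x / quadBump x₀ R x ^ (l + 2)) ^ 2 := by
    refine (((absorbable_sq_gradDot hpos).const_mul hpos (2 * M ^ 2)).add
      ((absorbable_sq_lap_cut hpos hl).const_mul hpos 2)).mono fun R hR x hx => ?_
    rw [abs_of_nonneg (by positivity), abs_of_nonneg (by positivity)]
    nlinarith [sq_nonneg (M * (gradDot u (quadBump x₀ R) x / quadBump x₀ R x)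
      - u x * lap (cut x₀ R (l + 2)) x / quadBump x₀ R x ^ (l + 2))]
  set β : ℝ → ESp n → ℝ := fun R x => gradDot u (quadBump x₀ R) x / quadBump x₀ R x with hβ
  set L : ℝ → ESp n → ℝ := fun R x =>
    u x * lap (cut x₀ R (l + 2)) x / quadBump x₀ R x ^ (l + 2) with hL
  set a : ℝ := s / 2 + 1 with ha
  have hab : Absorbable u p x₀ fun R x =>
      2 * a * M * (β R x * lap u x) + a * s * M * (β R x * (gradSq u x / u x)) +
      2 * a * (L R x * lap u x) + a * s * (L R x * (gradSq u x / u x)) +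
      (M * β R x + L R x) ^ 2 :=
    ((((((absorbable_gradDot_mul (x₀ := x₀) hpos (sq_lap_le_dens hpos)).const_mul hpos
      (2 * a * M)).add ((absorbable_gradDot_mul hpos (sq_grad_le_dens hpos)).const_mul hpos
      (a * s * M))).add ((absorbable_mul_lap_cut hpos hl (sq_lap_le_dens hpos)).const_mul
      hpos (2 * a))).add ((absorbable_mul_lap_cut hpos hl
      (sq_grad_le_dens hpos)).const_mul hpos (a * s))).add hsq)
  have he0 : ∀ R > 0, ∀ x, quadBump x₀ R x ≤ 0 →
      (lap (fun x => u x ^ a * cut x₀ R (l + 2) x) x) ^ 2 - wt u s x₀ (l + 2) R x *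
        (a ^ 2 * (lap u x ^ 2 + s * (lap u x * (gradSq u x / u x))
          + s ^ 2 / 4 * (gradSq u x / u x) ^ 2)) = 0 := by
    intro R hR x hx
    rw [hlap, wt_of_nonpos (by omega) hx, lap_cut_of_nonpos hl hR hx,
      cut_of_nonpos (by omega) hx, cut_of_nonpos (by omega) hx]
    ring
  have he : ∀ R > 0, ∀ x, 0 < quadBump x₀ R x →
      (lap (fun x => u x ^ a * cut x₀ R (l + 2) x) x) ^ 2 - wt u s x₀ (l + 2) R x *
        (a ^ 2 * (lap u x ^ 2 + s * (lap u x * (gradSq u x / u x))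
          + s ^ 2 / 4 * (gradSq u x / u x) ^ 2)) = wt u s x₀ (l + 2) R x *
      (2 * a * M * (β R x * lap u x) + a * s * M * (β R x * (gradSq u x / u x)) +
      2 * a * (L R x * lap u x) + a * s * (L R x * (gradSq u x / u x)) +
      (M * β R x + L R x) ^ 2) := by
    intro R hR x hx
    have h1 : gradDot u (quadBump x₀ R) x = β R x * quadBump x₀ R x := by
      rw [hβ]; field_simp
    have h2 : u x * lap (cut x₀ R (l + 2)) x = L R x * quadBump x₀ R x ^ (l + 2) := by
      rw [hL]; field_simp
    rw [hlap, wt_of_pos hx, cut_of_pos hx, cut_of_pos hx, hP, h1, h2]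
    ring
  refine ⟨fun R => ∫ x, ((lap (fun x => u x ^ a * cut x₀ R (l + 2) x) x) ^ 2
    - wt u s x₀ (l + 2) R x * (a ^ 2 * (lap u x ^ 2
        + s * (lap u x * (gradSq u x / u x)) + s ^ 2 / 4 * (gradSq u x / u x) ^ 2))), ?_, ?_⟩
  · intro ε hε
    exact abs_integral_le_of_absorbable hu2 hpos hp (by linarith) hm hab he he0 ε hε
  · intro R hR
    have hc : HasCompactSupport fun x => u x ^ a * cut x₀ R (l + 2) x :=
      (hasCompactSupport_cut x₀ hR (m := l + 2) (by omega)).mul_left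
    have h1 := integral_sq_le_integral_lap_sq (continuous_rpow_of_pos hu.continuous hpos (p - 1))
      hstab (hg R) hc
    have i1 := integrable_wt_mul (x₀ := x₀) hu.continuous hpos s (m := l + 2) (by omega) hR hf
    have hc2 := hc.lap (hg R)
    have hL2 := continuous_lap (hg R)
    have i2 : Integrable fun x => lap (fun x => u x ^ a * cut x₀ R (l + 2) x) x ^ 2 := by
      simp only [sq]
      exact (hL2.mul hL2).integrable_of_hasCompactSupport hc2.mul_left
    beta_reduce
    rw [integral_sub i2 i1]
    unfold wInt
    rw [add_sub_cancel]
    refine (le_of_eq ?_).trans h1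
    congr 1
    refine integral_congr_ae (Filter.Eventually.of_forall fun x => ?_)
    have := hpos x
    simp only [wt]
    have hcut : cut x₀ R (2 * (l + 2)) x = cut x₀ R (l + 2) x ^ 2 := by
      unfold cut posPow
      rw [← pow_mul, mul_comm]
    rw [rpow_sub_one this.ne', rpow_add_one this.ne', rpow_add_one this.ne', hP, hcut]
    field_simp

end Stability

section EnergyBounds

set_option maxHeartbeats 800000 in
/-- The algebraic core of the energy estimate for exponents `s > 0`. -/
lemma exists_energy_le_mul {p s c : ℝ} (hp : 1 < p) (hs : 0 < s) (hs1 : s < 1) (hc : 0 < c)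
    (hL : (s / 2 + 1) ^ 2 * (1 / (s + 1) + s ^ 2 / (1 - s ^ 2)
      * (1 / (s + 1) - c ^ 2 / (s + (p + 1) / 2) / 2)) < p) :
    ∃ k > 0, ∀ X A D E B F K Y τ : ℝ, 0 ≤ X → 0 ≤ D → 0 ≤ τ →
      |E - A + s * F - s * B| ≤ τ → |(s - 1) * D + 2 * F + B| ≤ τ →
      |Y + (s + (p + 1) / 2) * K| ≤ τ → |X - (s + 1) * A - s * (s + 1) * B| ≤ τ →
      p * X ≤ (s / 2 + 1) ^ 2 * (A + s * B + s ^ 2 / 4 * D) + τ →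
      (∀ α : ℝ, 0 ≤ E + 2 * α * F + α ^ 2 * D) → (∀ α : ℝ, 0 ≤ A + 2 * α * B + α ^ 2 * D) →
      c * K ≤ -B → c * X ≤ -Y → X + A + D + E ≤ k * τ := by
  set a := s + (p + 1) / 2 with ha
  have ha0 : 0 < a := by linarith
  set g := (s / 2 + 1) ^ 2 with hg
  have hg0 : 0 < g := by positivity
  have h1s : 0 < 1 - s ^ 2 := by nlinarith
  set r := s ^ 2 / (1 - s ^ 2) with hr
  have hr0 : 0 ≤ r := by positivity
  set e := 1 / (s + 1) with he
  have he0 : 0 < e := by positivity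
  have he1 : e * (s + 1) = 1 := by rw [he]; field_simp
  have he2 : e ≤ 1 := by nlinarith
  set δ := p - g * (e + r * (e - c ^ 2 / a / 2)) with hδ
  have hδ0 : 0 < δ := by linarith
  set b := c / a with hb
  have hb0 : 0 < b := by positivity
  set k1 := (1 + g * (1 + r * (3 + b / 2))) / δ with hk1
  have hk10 : 0 ≤ k1 := by positivity
  set k2 := 4 * (k1 + b / 2 + 3) / (1 - s ^ 2) with hk2
  have hk20 : 0 ≤ k2 := by positivity
  refine ⟨k1 + (2 * k1 + 2 + k2) + k2 + (k1 + 3 + b), by positivity, ?_⟩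
  intro X A D E B F K Y τ hX hD hτ h1 h2 h3 h4 h5 h6 h7 h8 h9
  rw [abs_le] at h1 h2 h3 h4
  have hK : c * X - τ ≤ a * K := by linarith [h3.1]
  have hB : B ≤ -(c ^ 2 / a * X) + b * τ := by
    have : c * (c * X - τ) / a ≤ c * K := by
      rw [div_le_iff₀ ha0]
      linarith [mul_le_mul_of_nonneg_left hK hc.le]
    have e1 : c * (c * X - τ) / a = c ^ 2 / a * X - b * τ := by
      rw [hb]; field_simp
    linarith
  have hAB : A + s * B ≤ e * X + τ := by
    have e1 : (s + 1) * A + s * (s + 1) * B ≤ X + τ := by linarith [h4.1]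
    have := mul_le_mul_of_nonneg_left e1 he0.le
    have e3 := mul_le_mul_of_nonneg_right he2 hτ
    have e2 : e * ((s + 1) * A + s * (s + 1) * B) = A + s * B := by
      linear_combination (A + s * B) * he1
    linarith
  have hDD : (1 - s ^ 2) / 4 * D ≤ e * X + B / 2 + 3 * τ := by
    have := h6 ((s - 1) / 2)
    linarith [h1.1, h1.2, h2.1, h2.2]
  have hsD : s ^ 2 / 4 * D ≤ r * (e * X + B / 2 + 3 * τ) := by
    have := mul_le_mul_of_nonneg_left hDD hr0
    have e3 : r * ((1 - s ^ 2) / 4 * D) = s ^ 2 / 4 * D := by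
      rw [hr]; field_simp
    linarith
  have hX1 : X ≤ k1 * τ := by
    rw [hk1, div_mul_eq_mul_div, le_div_iff₀ hδ0]
    have i1 : g * (A + s * B + s ^ 2 / 4 * D)
        ≤ g * (e * X + τ + r * (e * X + (-(c ^ 2 / a * X) + b * τ) / 2 + 3 * τ)) := by
      have : r * (e * X + B / 2 + 3 * τ)
          ≤ r * (e * X + (-(c ^ 2 / a * X) + b * τ) / 2 + 3 * τ) := by gcongr
      refine mul_le_mul_of_nonneg_left ?_ hg0.le
      linarith only [this, hAB, hsD]
    rw [hδ]
    linarith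
  have hcX : 0 ≤ c ^ 2 / a * X := by positivity
  have heX : e * X ≤ k1 * τ := by linarith [mul_le_mul_of_nonneg_right he2 hX]
  have hD1 : D ≤ k2 * τ := by
    rw [hk2, div_mul_eq_mul_div, le_div_iff₀ h1s]
    linarith
  have hA1 : A ≤ 2 * (k1 * τ) + 2 * τ + k2 * τ := by
    have i2 := h7 s
    have : s ^ 2 * D ≤ 1 * D := by gcongr; nlinarith
    linarith only [i2, this, hAB, heX, hD1]
  have hE1 : E ≤ k1 * τ + 3 * τ + b * τ := by
    have i1 : s * B ≤ b * τ := by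
      have : s * B ≤ s * (b * τ) := by gcongr; linarith
      have : s * (b * τ) ≤ 1 * (b * τ) := by gcongr
      linarith
    have i2 : s * (-2 * F) ≤ s * ((s - 1) * D + B + τ) := by gcongr; linarith [h2.1, h2.2]
    have i3 : s * ((s - 1) * D) ≤ 0 :=
      mul_nonpos_of_nonneg_of_nonpos hs.le (mul_nonpos_of_nonpos_of_nonneg (by linarith) hD)
    have i4 : s * τ ≤ 1 * τ := by gcongr
    have i5 : 0 ≤ b * τ := by positivity
    linarith [h1.2]
  linarith

/-- The algebraic core of the energy estimate for the exponent `s = 0`. -/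
lemma exists_energy_le_mul_of_zero {p : ℝ} (hp : 1 < p) :
    ∃ k > 0, ∀ X A D E B F τ : ℝ, 0 ≤ X → 0 ≤ D → 0 ≤ τ →
      |E - A| ≤ τ → |-D + 2 * F + B| ≤ τ → |X - A| ≤ τ → p * X ≤ A + τ →
      (∀ α : ℝ, 0 ≤ E + 2 * α * F + α ^ 2 * D) → (∀ α : ℝ, 0 ≤ A + 2 * α * B + α ^ 2 * D) →
      X + A + D + E ≤ k * τ := by
  have hp' : 0 < p - 1 := by linarith
  set k := 2 / (p - 1) with hk
  have hk0 : 0 < k := by positivity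
  refine ⟨15 * k + 27, by positivity, fun X A D E B F τ hX hD hτ h1 h2 h3 h4 h5 h6 => ?_⟩
  rw [abs_le] at h1 h2 h3
  have hX1 : X ≤ k * τ := by
    rw [hk, div_mul_eq_mul_div, le_div_iff₀ hp']
    linarith
  linarith [h5 (-1 / 2), h6 (-1 / 2)]

variable {n : ℕ} {u : ESp n → ℝ} {p : ℝ} {x₀ : ESp n} {m : ℕ}

lemma wInt_lincomb {s R : ℝ} (hu : Continuous u) (hpos : ∀ x, 0 < u x) (hm : m ≠ 0) (hR : 0 < R)
    {f g h k : ESp n → ℝ} (hf : Continuous f) (hg : Continuous g) (hh : Continuous h)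
    (hk : Continuous k) (a b c d : ℝ) :
    wInt u s x₀ m R (fun x => a * f x + b * g x + c * h x + d * k x) =
      a * wInt u s x₀ m R f + b * wInt u s x₀ m R g + c * wInt u s x₀ m R h
        + d * wInt u s x₀ m R k := by
  rw [wInt_add (f := fun x => a * f x + b * g x + c * h x) hu hpos hm hR (by fun_prop)
      (by fun_prop), wInt_add (f := fun x => a * f x + b * g x) hu hpos hm hR (by fun_prop)
      (by fun_prop), wInt_add hu hpos hm hR (by fun_prop) (by fun_prop)]
  simp only [wInt_const_mul]

end EnergyBounds

section EnergyDecay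

variable {n : ℕ} {u : ESp n → ℝ} {p : ℝ} {x₀ : ESp n} {m : ℕ}

lemma hess_quadratic_nonneg (hpos : ∀ x, 0 < u x) (α : ℝ) (x : ESp n) :
    0 ≤ hessSq u x + 2 * α * (hessGrad u x / u x) + α ^ 2 * (gradSq u x / u x) ^ 2 := by
  have h1 := hessGrad_sq_le u x
  have h2 := hessSq_nonneg u x
  have hu := hpos x
  set h := hessSq u x
  set d := gradSq u x / u x with hd
  set f := hessGrad u x / u x with hf
  have h3 : f ^ 2 ≤ d ^ 2 * h := by
    rw [hf, hd, div_pow, div_pow, div_mul_eq_mul_div]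
    gcongr
  rcases h2.eq_or_lt with h0 | h0
  · rw [← h0, mul_zero] at h3
    have : f = 0 := by
      have := sq_nonneg f
      exact pow_eq_zero_iff (two_ne_zero) |>.1 (le_antisymm h3 this)
    rw [← h0, this, mul_zero, add_zero, zero_add]
    positivity
  · refine nonneg_of_mul_nonneg_right (b := h + 2 * α * f + α ^ 2 * d ^ 2) ?_ h0
    nlinarith [sq_nonneg (h + α * f), mul_le_mul_of_nonneg_left h3 (sq_nonneg α)]

lemma wInt_dens {s R : ℝ} (hu : ContDiff ℝ 2 u) (hpos : ∀ x, 0 < u x) (hm : m ≠ 0) (hR : 0 < R) :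
    wInt u s x₀ m R (dens u p) = wInt u s x₀ m R (fun x => u x ^ (p + 1))
      + wInt u s x₀ m R (fun x => lap u x ^ 2)
      + wInt u s x₀ m R (fun x => (gradSq u x / u x) ^ 2) + wInt u s x₀ m R (hessSq u) := by
  have h := wInt_lincomb (s := s) (x₀ := x₀) hu.continuous hpos hm hR
    (continuous_rpow_of_pos hu.continuous hpos (p + 1)) ((continuous_lap hu).pow 2)
    ((continuous_grad_div (hu.of_le (by norm_num)) hpos).pow 2) (continuous_hessSq hu) 1 1 1 1
  simp only [one_mul] at h
  exact h

/-- Errors controlled by a small multiple of the energy are controlled by a power of the radius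
once they control the energy. -/
lemma energy_le_of_forall_error {s k : ℝ} (hpos : ∀ x, 0 < u x) (hk : 0 < k)
    {Q : ℝ → ℝ → Prop}
    (hQ : ∀ ε > 0, ∃ C ≥ 0, ∀ R > 0, Q R (ε * wInt u s x₀ m R (dens u p)
      + C * R ^ ((n : ℝ) - (4 + 4 * ((s + 2) / (p - 1))))))
    (h : ∀ R > 0, ∀ τ ≥ 0, Q R τ → wInt u s x₀ m R (dens u p) ≤ k * τ) :
    ∃ C ≥ 0, ∀ R > 0, wInt u s x₀ m R (dens u p)
      ≤ C * R ^ ((n : ℝ) - (4 + 4 * ((s + 2) / (p - 1)))) := by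
  obtain ⟨C, hC, hq⟩ := hQ (1 / (2 * k)) (by positivity)
  refine ⟨2 * k * C, by positivity, fun R hR => ?_⟩
  have h0 : 0 ≤ wInt u s x₀ m R (dens u p) := wInt_nonneg hpos (dens_nonneg hpos)
  have h1 := h R hR _ (by positivity) (hq R hR)
  have e : k * (1 / (2 * k) * wInt u s x₀ m R (dens u p)
      + C * R ^ ((n : ℝ) - (4 + 4 * ((s + 2) / (p - 1)))))
      = wInt u s x₀ m R (dens u p) / 2
        + k * (C * R ^ ((n : ℝ) - (4 + 4 * ((s + 2) / (p - 1))))) := by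
    field_simp
  rw [e] at h1
  linarith

/-- All integral identities up to a common error `τ`. -/
def IntegralBounds (u : ESp n → ℝ) (p s : ℝ) (x₀ : ESp n) (m : ℕ) (R τ : ℝ) : Prop :=
  |wInt u s x₀ m R (hessSq u) - wInt u s x₀ m R (fun x => lap u x ^ 2)
    + s * wInt u s x₀ m R (fun x => hessGrad u x / u x)
    - s * wInt u s x₀ m R (fun x => lap u x * (gradSq u x / u x))| ≤ τ ∧
  |(s - 1) * wInt u s x₀ m R (fun x => (gradSq u x / u x) ^ 2)
    + 2 * wInt u s x₀ m R (fun x => hessGrad u x / u x)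
    + wInt u s x₀ m R (fun x => lap u x * (gradSq u x / u x))| ≤ τ ∧
  |wInt u s x₀ m R (fun x => u x ^ ((p + 1) / 2) * lap u x) + (s + (p + 1) / 2)
    * wInt u s x₀ m R (fun x => u x ^ ((p + 1) / 2) * (gradSq u x / u x))| ≤ τ ∧
  |wInt u s x₀ m R (fun x => u x ^ (p + 1))
    - (s + 1) * wInt u s x₀ m R (fun x => lap u x ^ 2)
    - s * (s + 1) * wInt u s x₀ m R (fun x => lap u x * (gradSq u x / u x))| ≤ τ ∧
  p * wInt u s x₀ m R (fun x => u x ^ (p + 1)) ≤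
    (s / 2 + 1) ^ 2 * (wInt u s x₀ m R (fun x => lap u x ^ 2)
      + s * wInt u s x₀ m R (fun x => lap u x * (gradSq u x / u x))
      + s ^ 2 / 4 * wInt u s x₀ m R (fun x => (gradSq u x / u x) ^ 2)) + τ

lemma exists_integralBounds {s : ℝ} (hu : ContDiff ℝ 4 u) (hpos : ∀ x, 0 < u x) (hp : 1 < p)
    (hs : 0 ≤ s) (hm : 2 + 2 * ((s + 2) / (p - 1)) ≤ m)
    (heq : ∀ x, lap (lap u) x = u x ^ p)
    (hstab : ∀ φ : ESp n → ℝ, ContDiff ℝ (⊤ : ℕ∞) φ → HasCompactSupport φ →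
      p * ∫ x, u x ^ (p - 1) * φ x ^ 2 ≤ ∫ x, (lap φ x) ^ 2) :
    ∀ ε > 0, ∃ C ≥ 0, ∀ R > 0, IntegralBounds u p s x₀ m R (ε * wInt u s x₀ m R (dens u p)
      + C * R ^ ((n : ℝ) - (4 + 4 * ((s + 2) / (p - 1))))) := by
  intro ε hε
  have hm0 : m ≠ 0 := by have := three_le_of_bound hp hs hm; omega
  have hu2 : ContDiff ℝ 2 u := hu.of_le (by norm_num)
  have hu1 : ContDiff ℝ 1 u := hu.of_le (by norm_num)
  obtain ⟨C1, hC1, h1⟩ := negligible_hess (x₀ := x₀) hu hpos hp hs hm ε hε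
  obtain ⟨C2, hC2, h2⟩ := negligible_gradSq (x₀ := x₀) hu hpos hp hs hm ε hε
  obtain ⟨C3, hC3, h3⟩ := negligible_grad (x₀ := x₀) hu hpos hp hs hm ε hε
  obtain ⟨C4, hC4, h4⟩ := negligible_equation (x₀ := x₀) hu hpos hp hs hm heq ε hε
  obtain ⟨F, hF, hst⟩ := negligible_stability (x₀ := x₀) hu hpos hp hs hm hstab
  obtain ⟨C5, hC5, h5⟩ := hF ε hε
  refine ⟨C1 + C2 + C3 + C4 + C5, by positivity, fun R hR => ?_⟩
  have hP0 : 0 ≤ R ^ ((n : ℝ) - (4 + 4 * ((s + 2) / (p - 1)))) := by positivity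
  set P := R ^ ((n : ℝ) - (4 + 4 * ((s + 2) / (p - 1))))
  have m1 : C1 * P ≤ (C1 + C2 + C3 + C4 + C5) * P := by gcongr; linarith
  have m2 : C2 * P ≤ (C1 + C2 + C3 + C4 + C5) * P := by gcongr; linarith
  have m3 : C3 * P ≤ (C1 + C2 + C3 + C4 + C5) * P := by gcongr; linarith
  have m4 : C4 * P ≤ (C1 + C2 + C3 + C4 + C5) * P := by gcongr; linarith
  have m5 : C5 * P ≤ (C1 + C2 + C3 + C4 + C5) * P := by gcongr; linarith
  have cE := continuous_hessSq hu2
  have cA : Continuous fun x => lap u x ^ 2 := (continuous_lap hu2).pow 2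
  have cF := continuous_hessGrad_div hu2 hpos
  have cG := continuous_grad_div hu1 hpos
  have cB : Continuous fun x => lap u x * (gradSq u x / u x) := (continuous_lap hu2).mul cG
  have cD : Continuous fun x => (gradSq u x / u x) ^ 2 := cG.pow 2
  have cX := continuous_rpow_of_pos hu.continuous hpos (p + 1)
  have cQ := continuous_rpow_of_pos hu.continuous hpos ((p + 1) / 2)
  have cY : Continuous fun x => u x ^ ((p + 1) / 2) * lap u x := cQ.mul (continuous_lap hu2)
  have cK : Continuous fun x => u x ^ ((p + 1) / 2) * (gradSq u x / u x) := cQ.mul cG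
  have lin := fun {f g h k : ESp n → ℝ} =>
    wInt_lincomb (s := s) (x₀ := x₀) hu.continuous hpos hm0 hR (f := f) (g := g) (h := h) (k := k)
  refine ⟨?_, ?_, ?_, ?_, ?_⟩
  · refine le_trans (le_of_eq ?_) ((h1 R hR).trans (add_le_add le_rfl m1))
    have := lin cE cA cF cB 1 (-1) s (-s)
    refine congrArg abs (Eq.trans ?_ (this.symm.trans
      (congrArg (wInt u s x₀ m R) (funext fun x => ?_)))) <;> ring
  · refine le_trans (le_of_eq ?_) ((h2 R hR).trans (add_le_add le_rfl m2))
    have := lin cD cF cB cB (s - 1) 2 1 0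
    refine congrArg abs (Eq.trans ?_ (this.symm.trans
      (congrArg (wInt u s x₀ m R) (funext fun x => ?_)))) <;> ring
  · refine le_trans (le_of_eq ?_) ((h3 R hR).trans (add_le_add le_rfl m3))
    have := lin cY cK cB cB 1 (s + (p + 1) / 2) 0 0
    refine congrArg abs (Eq.trans ?_ (this.symm.trans
      (congrArg (wInt u s x₀ m R) (funext fun x => ?_)))) <;> ring
  · refine le_trans (le_of_eq ?_) ((h4 R hR).trans (add_le_add le_rfl m4))
    have := lin cX cA cB cB 1 (-(s + 1)) (-(s * (s + 1))) 0
    refine congrArg abs (Eq.trans ?_ (this.symm.trans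
      (congrArg (wInt u s x₀ m R) (funext fun x => ?_)))) <;> ring
  · refine (hst R hR).trans (add_le_add (le_of_eq ?_)
      ((le_abs_self _).trans ((h5 R hR).trans (add_le_add le_rfl m5))))
    have := lin cA cB cD cD ((s / 2 + 1) ^ 2) ((s / 2 + 1) ^ 2 * s)
      ((s / 2 + 1) ^ 2 * (s ^ 2 / 4)) 0
    refine Eq.trans (congrArg (wInt u s x₀ m R) (funext fun x => ?_)) (this.trans ?_) <;> ring

lemma wInt_hess_quadratic_nonneg {s R : ℝ} (hu : ContDiff ℝ 2 u) (hpos : ∀ x, 0 < u x)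
    (hm : m ≠ 0) (hR : 0 < R) (α : ℝ) :
    0 ≤ wInt u s x₀ m R (hessSq u) + 2 * α * wInt u s x₀ m R (fun x => hessGrad u x / u x)
      + α ^ 2 * wInt u s x₀ m R (fun x => (gradSq u x / u x) ^ 2) := by
  have cD : Continuous fun x => (gradSq u x / u x) ^ 2 :=
    (continuous_grad_div (hu.of_le (by norm_num)) hpos).pow 2
  have h := wInt_lincomb (s := s) (x₀ := x₀) hu.continuous hpos hm hR
    (continuous_hessSq hu) (continuous_hessGrad_div hu hpos) cD cD 1 (2 * α) (α ^ 2) 0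
  have h1 := wInt_nonneg (s := s) (x₀ := x₀) (m := m) (R := R) hpos
    (hess_quadratic_nonneg hpos α)
  simp only [one_mul, zero_mul, add_zero] at h
  rwa [h] at h1

lemma wInt_lap_quadratic_nonneg {s R : ℝ} (hu : ContDiff ℝ 2 u) (hpos : ∀ x, 0 < u x)
    (hm : m ≠ 0) (hR : 0 < R) (α : ℝ) :
    0 ≤ wInt u s x₀ m R (fun x => lap u x ^ 2)
      + 2 * α * wInt u s x₀ m R (fun x => lap u x * (gradSq u x / u x))
      + α ^ 2 * wInt u s x₀ m R (fun x => (gradSq u x / u x) ^ 2) := by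
  have cG := continuous_grad_div (hu.of_le (by norm_num)) hpos
  have cA : Continuous fun x => lap u x ^ 2 := (continuous_lap hu).pow 2
  have cB : Continuous fun x => lap u x * (gradSq u x / u x) := (continuous_lap hu).mul cG
  have cD : Continuous fun x => (gradSq u x / u x) ^ 2 := cG.pow 2
  have h := wInt_lincomb (s := s) (x₀ := x₀) hu.continuous hpos hm hR cA cB cD cD
    1 (2 * α) (α ^ 2) 0
  have h1 : 0 ≤ wInt u s x₀ m R (fun x => lap u x ^ 2
      + 2 * α * (lap u x * (gradSq u x / u x)) + α ^ 2 * (gradSq u x / u x) ^ 2) := by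
    refine wInt_nonneg hpos fun x => ?_
    nlinarith [sq_nonneg (lap u x + α * (gradSq u x / u x))]
  simp only [one_mul, zero_mul, add_zero] at h
  rwa [h] at h1

/-- Energy decay with the plain cutoff weight. -/
lemma energy_le_of_zero (hu : ContDiff ℝ 4 u) (hpos : ∀ x, 0 < u x) (hp : 1 < p)
    (hm : 2 + 2 * ((0 + 2) / (p - 1)) ≤ m)
    (heq : ∀ x, lap (lap u) x = u x ^ p)
    (hstab : ∀ φ : ESp n → ℝ, ContDiff ℝ (⊤ : ℕ∞) φ → HasCompactSupport φ →
      p * ∫ x, u x ^ (p - 1) * φ x ^ 2 ≤ ∫ x, (lap φ x) ^ 2) :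
    ∃ C ≥ 0, ∀ R > 0, wInt u 0 x₀ m R (dens u p)
      ≤ C * R ^ ((n : ℝ) - (4 + 4 * ((0 + 2) / (p - 1)))) := by
  have hm0 : m ≠ 0 := by have := three_le_of_bound hp le_rfl hm; omega
  have hu2 : ContDiff ℝ 2 u := hu.of_le (by norm_num)
  obtain ⟨k, hk, h⟩ := exists_energy_le_mul_of_zero hp
  refine energy_le_of_forall_error hpos hk
    (exists_integralBounds hu hpos hp le_rfl hm heq hstab) fun R hR τ hτ hQ => ?_
  obtain ⟨h1, h2, h3, h4, h5⟩ := hQ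
  rw [wInt_dens hu2 hpos hm0 hR]
  refine h _ _ _ _ (wInt u 0 x₀ m R (fun x => lap u x * (gradSq u x / u x)))
    (wInt u 0 x₀ m R (fun x => hessGrad u x / u x)) τ
    (wInt_nonneg hpos fun x => (rpow_pos_of_pos (hpos x) _).le)
    (wInt_nonneg hpos fun x => sq_nonneg _) hτ ?_ ?_ ?_ ?_
    (wInt_hess_quadratic_nonneg hu2 hpos hm0 hR) (wInt_lap_quadratic_nonneg hu2 hpos hm0 hR)
  · simpa using h1
  · simpa using h2
  · simpa using h4
  · simpa using h5

/-- Energy decay with the weight `u ^ s`, for solutions satisfying a pointwise lower bound on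
`-Δu`. -/
lemma energy_le_of_pos {s c : ℝ} (hu : ContDiff ℝ 4 u) (hpos : ∀ x, 0 < u x) (hp : 1 < p)
    (hs : 0 < s) (hs1 : s < 1) (hm : 2 + 2 * ((s + 2) / (p - 1)) ≤ m)
    (heq : ∀ x, lap (lap u) x = u x ^ p)
    (hstab : ∀ φ : ESp n → ℝ, ContDiff ℝ (⊤ : ℕ∞) φ → HasCompactSupport φ →
      p * ∫ x, u x ^ (p - 1) * φ x ^ 2 ≤ ∫ x, (lap φ x) ^ 2)
    (hc : 0 < c) (hlap : ∀ x, c * u x ^ ((p + 1) / 2) ≤ -lap u x)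
    (hL : (s / 2 + 1) ^ 2 * (1 / (s + 1) + s ^ 2 / (1 - s ^ 2)
      * (1 / (s + 1) - c ^ 2 / (s + (p + 1) / 2) / 2)) < p) :
    ∃ C ≥ 0, ∀ R > 0, wInt u s x₀ m R (dens u p)
      ≤ C * R ^ ((n : ℝ) - (4 + 4 * ((s + 2) / (p - 1)))) := by
  have hm0 : m ≠ 0 := by have := three_le_of_bound hp hs.le hm; omega
  have hu2 : ContDiff ℝ 2 u := hu.of_le (by norm_num)
  have hu1 : ContDiff ℝ 1 u := hu.of_le (by norm_num)
  have cG := continuous_grad_div hu1 hpos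
  have cL := continuous_lap hu2
  have cQ := continuous_rpow_of_pos hu.continuous hpos ((p + 1) / 2)
  have cX := continuous_rpow_of_pos hu.continuous hpos (p + 1)
  obtain ⟨k, hk, h⟩ := exists_energy_le_mul hp hs hs1 hc hL
  refine energy_le_of_forall_error hpos hk
    (exists_integralBounds hu hpos hp hs.le hm heq hstab) fun R hR τ hτ hQ => ?_
  obtain ⟨h1, h2, h3, h4, h5⟩ := hQ
  rw [wInt_dens hu2 hpos hm0 hR]
  refine h _ _ _ _ _ _ _ _ τ
    (wInt_nonneg hpos fun x => (rpow_pos_of_pos (hpos x) _).le)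
    (wInt_nonneg hpos fun x => sq_nonneg _) hτ h1 h2 h3 h4 h5
    (wInt_hess_quadratic_nonneg hu2 hpos hm0 hR) (wInt_lap_quadratic_nonneg hu2 hpos hm0 hR) ?_ ?_
  · rw [← wInt_const_mul, ← neg_one_mul (wInt _ _ _ _ _ _), ← wInt_const_mul]
    refine wInt_mono hu.continuous hpos hm0 hR (continuous_const.mul (cQ.mul cG))
      (continuous_const.mul (cL.mul cG)) fun x => ?_
    have := mul_le_mul_of_nonneg_right (hlap x) (div_nonneg_gradSq hpos x)
    linarith
  · rw [← wInt_const_mul, ← neg_one_mul (wInt _ _ _ _ _ _), ← wInt_const_mul]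
    refine wInt_mono hu.continuous hpos hm0 hR (continuous_const.mul cX)
      (continuous_const.mul (cQ.mul cL)) fun x => ?_
    have := mul_le_mul_of_nonneg_right (hlap x) (rpow_pos_of_pos (hpos x) ((p + 1) / 2)).le
    have e : u x ^ (p + 1) = u x ^ ((p + 1) / 2) * u x ^ ((p + 1) / 2) := by
      rw [← rpow_add (hpos x)]; ring_nf
    rw [e]
    linarith

end EnergyDecay

section SubharmonicMeans

variable {n : ℕ}

lemma hasDerivAt_cut (x₀ x : ESp n) {k : ℕ} (hk : 1 ≤ k) {R : ℝ} (hR : 0 < R) :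
    HasDerivAt (fun r => cut x₀ r (k + 1) x)
      ((k + 1) * cut x₀ R k x * (2 * ‖x - x₀‖ ^ 2 / R ^ 3)) R := by
  have h1 : HasDerivAt (fun r => quadBump x₀ r x) (2 * ‖x - x₀‖ ^ 2 / R ^ 3) R := by
    have h2 := (((hasDerivAt_pow 2 R).inv (by positivity)).const_mul (‖x - x₀‖ ^ 2)).const_sub 1
    unfold quadBump
    refine h2.congr_deriv ?_
    simp only [Nat.cast_ofNat, Nat.add_one_sub_one, pow_one]
    field_simp
  exact (hasDerivAt_posPow k hk _).comp R h1

lemma hasDerivAt_integral_mul_cut {f : ESp n → ℝ} (hf : Continuous f) (x₀ : ESp n) {k : ℕ}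
    (hk : 1 ≤ k) {R : ℝ} (hR : 0 < R) :
    HasDerivAt (fun r => ∫ x, f x * cut x₀ r (k + 1) x)
      (∫ x, f x * ((k + 1) * cut x₀ R k x * (2 * ‖x - x₀‖ ^ 2 / R ^ 3))) R := by
  have hcont : ∀ r, Continuous fun x => f x * cut x₀ r (k + 1) x := fun r =>
    hf.mul (continuous_cut x₀ r _)
  have hcont' : ∀ r, Continuous fun x =>
      f x * ((k + 1) * cut x₀ r k x * (2 * ‖x - x₀‖ ^ 2 / r ^ 3)) := fun r => by
    have := continuous_cut x₀ r k
    fun_prop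
  refine (hasDerivAt_integral_of_dominated_loc_of_deriv_le
    (F := fun r x => f x * cut x₀ r (k + 1) x)
    (F' := fun r x => f x * ((k + 1) * cut x₀ r k x * (2 * ‖x - x₀‖ ^ 2 / r ^ 3)))
    (bound := (Metric.closedBall x₀ (2 * R)).indicator fun x =>
      |f x| * ((k + 1) * 1 * (2 * (2 * R) ^ 2 / (R / 2) ^ 3)))
    (s := Set.Ioo (R / 2) (2 * R)) (Ioo_mem_nhds (by linarith) (by linarith))
    (Filter.Eventually.of_forall fun r => (hcont r).aestronglyMeasurable)
    ((hcont R).integrable_of_hasCompactSupport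
      (hasCompactSupport_cut x₀ hR (by omega)).mul_left) (hcont' R).aestronglyMeasurable
    (Filter.Eventually.of_forall fun x r hr => ?_) ?_
    (Filter.Eventually.of_forall fun x r hr => ?_)).2
  · have hr0 : 0 < r := by linarith [hr.1]
    by_cases hx : x ∈ Metric.closedBall x₀ (2 * R)
    · rw [Set.indicator_of_mem hx, Real.norm_eq_abs, abs_mul]
      rw [Metric.mem_closedBall, dist_eq_norm] at hx
      have h0 := cut_nonneg x₀ r k x
      rw [abs_of_nonneg (a := (k + 1) * cut x₀ r k x * _) (by positivity)]
      gcongr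
      · exact cut_le_one x₀ r k x
      · exact hr.1.le
    · rw [Set.indicator_of_notMem hx]
      rw [Metric.mem_closedBall, dist_eq_norm, not_le] at hx
      rw [cut_eq_zero x₀ hr0 (by omega) (by linarith [hr.2])]
      simp
  · rw [integrable_indicator_iff Metric.isClosed_closedBall.measurableSet]
    exact (hf.abs.mul continuous_const).continuousOn.integrableOn_compact
      (isCompact_closedBall _ _)
  · exact (hasDerivAt_cut x₀ x hk (by linarith [hr.1])).const_mul (f x)

/-- The weighted means of a subharmonic function increase with the radius. -/
lemma monotoneOn_mean_of_subharmonic {f : ESp n → ℝ} (hf : ContDiff ℝ 2 f)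
    (hsub : ∀ x, 0 ≤ lap f x) (x₀ : ESp n) {k : ℕ} (hk : 1 ≤ k) :
    MonotoneOn (fun r : ℝ => (r ^ n)⁻¹ * ∫ x, f x * cut x₀ r (k + 1) x) (Set.Ioi 0) := by
  have key : ∀ R ∈ Set.Ioi (0 : ℝ), ∃ d ≥ 0,
      HasDerivAt (fun r : ℝ => (r ^ n)⁻¹ * ∫ x, f x * cut x₀ r (k + 1) x) d R := by
    intro R hR
    have hR : 0 < R := hR
    have h1 := ((hasDerivAt_pow n R).inv (by positivity)).mul
      (hasDerivAt_integral_mul_cut hf.continuous x₀ hk hR)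
    refine ⟨_, ?_, h1⟩
    have hc : ContDiff ℝ 2 (cut x₀ R (k + 2)) := contDiff_cut x₀ R (k := 2) (by omega)
    have hs : HasCompactSupport (cut x₀ R (k + 2)) := hasCompactSupport_cut x₀ hR (by omega)
    have h2 := integral_mul_lap hf hc hs
    have h3 : 0 ≤ ∫ x, f x * lap (cut x₀ R (k + 2)) x := by
      rw [← h2]
      exact integral_nonneg fun x => mul_nonneg (hsub x) (cut_nonneg _ _ _ _)
    have i1 : Integrable fun x => f x * cut x₀ R (k + 1) x :=
      (hf.continuous.mul (continuous_cut _ _ _)).integrable_of_hasCompactSupport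
        (hasCompactSupport_cut x₀ hR (by omega)).mul_left
    have i2 : Integrable fun x => f x * ((k + 1) * cut x₀ R k x * (2 * ‖x - x₀‖ ^ 2 / R ^ 3)) := by
      have hck := continuous_cut x₀ R k
      have hfc := hf.continuous
      refine Continuous.integrable_of_hasCompactSupport (by fun_prop) ?_
      exact ((hasCompactSupport_cut x₀ hR (by omega)).mul_left.mul_right).mul_left
    have e : ∫ x, f x * lap (cut x₀ R (k + 2)) x = (k + 2) * 2 / R *
        (∫ x, f x * ((k + 1) * cut x₀ R k x * (2 * ‖x - x₀‖ ^ 2 / R ^ 3)))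
        - (k + 2) * 2 / R ^ 2 * n * ∫ x, f x * cut x₀ R (k + 1) x := by
      rw [← integral_const_mul, ← integral_const_mul, ← integral_sub (i2.const_mul _)
        (i1.const_mul _)]
      refine integral_congr_ae (Filter.Eventually.of_forall fun x => ?_)
      simp only
      rw [lap_cut x₀ R hk]
      field_simp
      ring
    rw [e] at h3
    set G := ∫ x, f x * cut x₀ R (k + 1) x
    set G' := ∫ x, f x * ((k + 1) * cut x₀ R k x * (2 * ‖x - x₀‖ ^ 2 / R ^ 3))
    have h4 : (R ^ n)⁻¹ * (R / ((k + 2) * 2)) * ((k + 2) * 2 / R * G'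
        - (k + 2) * 2 / R ^ 2 * n * G) = -(n * R ^ (n - 1)) / (R ^ n) ^ 2 * G + (R ^ n)⁻¹ * G' := by
      rcases Nat.eq_zero_or_pos n with hn | hn
      · rw [hn]
        simp
        field_simp
      · obtain ⟨l, hl⟩ : ∃ l, n = l + 1 := ⟨n - 1, by omega⟩
        rw [show n - 1 = l by omega, show R ^ n = R ^ l * R by rw [hl, pow_succ]]
        field_simp
        ring
    refine le_of_le_of_eq (b := _) (mul_nonneg (by positivity) h3) h4
  refine monotoneOn_of_deriv_nonneg (convex_Ioi 0) ?_ ?_ ?_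
  · exact fun R hR => (key R hR).choose_spec.2.continuousAt.continuousWithinAt
  · rw [interior_Ioi]
    exact fun R hR => (key R hR).choose_spec.2.differentiableAt.differentiableWithinAt
  · rw [interior_Ioi]
    intro R hR
    obtain ⟨d, hd, h⟩ := key R hR
    rwa [h.deriv]

/-- A nonnegative subharmonic function whose weighted means tend to zero vanishes. -/
lemma eq_zero_of_subharmonic {f : ESp n → ℝ} (hf : ContDiff ℝ 2 f) (hf0 : ∀ x, 0 ≤ f x)
    (hsub : ∀ x, 0 ≤ lap f x) (x₀ : ESp n) {k : ℕ} (hk : 1 ≤ k) {C θ : ℝ} (hθ : 0 < θ)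
    (hb : ∀ R > 0, (R ^ n)⁻¹ * ∫ x, f x * cut x₀ R (k + 1) x ≤ C * R ^ (-θ)) : f x₀ = 0 := by
  have hmono := monotoneOn_mean_of_subharmonic hf hsub x₀ hk
  have hlim : Filter.Tendsto (fun R : ℝ => C * R ^ (-θ)) Filter.atTop (nhds 0) := by
    simpa using (tendsto_rpow_neg_atTop hθ).const_mul C
  have h1 : ((1 : ℝ) ^ n)⁻¹ * ∫ x, f x * cut x₀ 1 (k + 1) x ≤ 0 := by
    refine ge_of_tendsto hlim ?_
    filter_upwards [Filter.eventually_ge_atTop 1] with R hR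
    exact (hmono (by simp) (by simp; linarith) hR).trans (hb R (by linarith))
  rw [one_pow, inv_one, one_mul] at h1
  have hc : Continuous fun x => f x * cut x₀ 1 (k + 1) x :=
    hf.continuous.mul (continuous_cut _ _ _)
  have hi : Integrable fun x => f x * cut x₀ 1 (k + 1) x :=
    hc.integrable_of_hasCompactSupport (hasCompactSupport_cut x₀ one_pos (by omega)).mul_left
  have hnn : ∀ x, 0 ≤ f x * cut x₀ 1 (k + 1) x := fun x =>
    mul_nonneg (hf0 x) (cut_nonneg _ _ _ _)
  by_contra hne
  have : 0 < ∫ x, f x * cut x₀ 1 (k + 1) x := by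
    refine hc.integral_pos_of_hasCompactSupport_nonneg_nonzero
      (hasCompactSupport_cut x₀ one_pos (by omega)).mul_left hnn (x := x₀) ?_
    simpa [cut, quadBump, posPow] using hne
  linarith

end SubharmonicMeans

section PointwiseBound

variable {n : ℕ}

lemma pd_const (c : ℝ) (i : Fin n) : pd i (fun _ : ESp n => c) = fun _ => 0 := by
  funext x
  simp [pd]

lemma lap_const (c : ℝ) (x : ESp n) : lap (fun _ : ESp n => c) x = 0 := by
  rw [lap_eq_sum contDiff_const]
  exact Finset.sum_eq_zero fun i _ => by rw [pd_const, pd_const]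

lemma gradDot_const (u : ESp n → ℝ) (c : ℝ) (x : ESp n) : gradDot u (fun _ => c) x = 0 :=
  Finset.sum_eq_zero fun i _ => by rw [pd_const, mul_zero]

lemma lap_add {f g : ESp n → ℝ} (hf : ContDiff ℝ 2 f) (hg : ContDiff ℝ 2 g) (x : ESp n) :
    lap (fun y => f y + g y) x = lap f x + lap g x := by
  rw [lap_eq_sum (hf.add hg), lap_eq_sum hf, lap_eq_sum hg, ← Finset.sum_add_distrib]
  refine Finset.sum_congr rfl fun i _ => ?_
  rw [show pd i (fun y => f y + g y) = fun y => pd i f y + pd i g y from funext fun y =>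
    pd_add (hf.differentiable (by norm_num) y) (hg.differentiable (by norm_num) y) i]
  exact pd_add ((ContDiff.pd (k := 1) hf i).differentiable (by norm_num) x)
    ((ContDiff.pd (k := 1) hg i).differentiable (by norm_num) x) i

lemma pd_one_add_posPow {w : ESp n → ℝ} (hw : ContDiff ℝ 2 w) (i : Fin n) (x : ESp n) :
    pd i (fun y => 1 + posPow 4 (w y)) x = 4 * posPow 3 (w x) * pd i w x := by
  have h := hasDerivAt_posPow 3 (by norm_num) (w x)
  norm_num at h
  replace h := h.const_add 1
  exact pd_comp (h := fun y => 1 + posPow 4 y) (hw.differentiable (by norm_num) x) h i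

lemma lap_one_add_posPow {w : ESp n → ℝ} (hw : ContDiff ℝ 2 w) (x : ESp n) :
    lap (fun y => 1 + posPow 4 (w y)) x
      = 12 * posPow 2 (w x) * gradSq w x + 4 * posPow 3 (w x) * lap w x := by
  have hv : ContDiff ℝ 2 fun y => 1 + posPow 4 (w y) :=
    contDiff_const.add ((contDiff_posPow 2 4 (by norm_num)).comp hw)
  rw [lap_eq_sum hv, lap_eq_sum hw, gradSq, Finset.mul_sum, Finset.mul_sum,
    ← Finset.sum_add_distrib]
  refine Finset.sum_congr rfl fun i _ => ?_
  rw [show pd i (fun y => 1 + posPow 4 (w y)) = fun y => 4 * posPow 3 (w y) * pd i w y from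
    funext fun y => pd_one_add_posPow hw i y]
  have h := (hasDerivAt_posPow 2 (by norm_num) (w x)).const_mul 4
  norm_num at h
  have dw := hw.differentiable (by norm_num) x
  have dp : DifferentiableAt ℝ (pd i w) x :=
    (ContDiff.pd (k := 1) hw i).differentiable (by norm_num) x
  have dh : DifferentiableAt ℝ (fun y => 4 * posPow 3 (w y)) x := h.differentiableAt.comp x dw
  rw [pd_mul dh dp, pd_comp (h := fun y => 4 * posPow 3 y) dw h]
  ring

/-- A function which is subharmonic where it is positive, and whose square has weighted means
tending to zero, is nonpositive. -/
lemma nonpos_of_subharmonic {w : ESp n → ℝ} (hw : ContDiff ℝ 2 w)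
    (hsub : ∀ x, 0 < w x → 0 ≤ lap w x) {k : ℕ} (hk : 1 ≤ k) {C θ : ℝ} (hθ : 0 < θ)
    (x₀ : ESp n) (hb : ∀ R > 0, (R ^ n)⁻¹ * ∫ x, w x ^ 2 * cut x₀ R (k + 1) x ≤ C * R ^ (-θ)) :
    w x₀ ≤ 0 := by
  set v : ESp n → ℝ := fun y => 1 + posPow 4 (w y) with hv_def
  have hv1 : ∀ x, 1 ≤ v x := fun x => le_add_of_nonneg_right (posPow_nonneg _ _)
  have hv0 : ∀ x, 0 < v x := fun x => one_pos.trans_le (hv1 x)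
  have hv : ContDiff ℝ 2 v :=
    contDiff_const.add ((contDiff_posPow 2 4 (by norm_num)).comp hw)
  have hvs : ContDiff ℝ 2 fun y => v y ^ (1 / 2 : ℝ) :=
    hv.rpow_const_of_ne fun x => (hv0 x).ne'
  set f : ESp n → ℝ := fun y => v y ^ (1 / 2 : ℝ) - 1 with hf_def
  have hf : ContDiff ℝ 2 f := hvs.sub contDiff_const
  have hf0 : ∀ x, 0 ≤ f x := fun x =>
    sub_nonneg.2 (one_le_rpow (hv1 x) (by norm_num))
  have hf1 : ∀ x, f x ≤ w x ^ 2 := by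
    intro x
    have h1 : v x ≤ (1 + w x ^ 2) ^ 2 := by
      have : posPow 4 (w x) ≤ w x ^ 4 := by
        rcases le_total 0 (w x) with h | h
        · exact (posPow_of_nonneg 4 h).le
        · rw [posPow_of_nonpos (by norm_num) h]; positivity
      simp only [hv_def]
      nlinarith [sq_nonneg (w x)]
    have h2 : v x ^ (1 / 2 : ℝ) ≤ 1 + w x ^ 2 := by
      rw [← sqrt_eq_rpow]
      exact sqrt_le_iff.2 ⟨by positivity, h1⟩
    simp only [hf_def]
    linarith
  have hlap : ∀ x, 0 ≤ lap f x := by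
    intro x
    have e : lap f x = lap (fun y => v y ^ (1 / 2 : ℝ) * (fun _ => 1) y) x := by
      simp only [mul_one]
      rw [show f = fun y => v y ^ (1 / 2 : ℝ) + (fun _ => -1) y from rfl,
        lap_add hvs contDiff_const, lap_const, add_zero]
    rw [e, lap_rpow_mul hv hv0 contDiff_const]
    have c3 : gradSq v x = 16 * posPow 3 (w x) ^ 2 * gradSq w x := by
      rw [gradSq, gradSq, Finset.mul_sum]
      refine Finset.sum_congr rfl fun i _ => ?_
      rw [pd_one_add_posPow hw]; ring
    have c4 : v x ^ ((1 : ℝ) / 2 - 1) = v x * v x ^ ((1 : ℝ) / 2 - 2) := by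
      rw [← rpow_one_add' (hv0 x).le (by norm_num)]; norm_num
    rw [gradDot_const, lap_const, c3, c4, lap_one_add_posPow hw]
    have hA := rpow_pos_of_pos (hv0 x) ((1 : ℝ) / 2 - 2)
    have hG := gradSq_nonneg w x
    have hL : 0 ≤ posPow 3 (w x) * lap w x := by
      rcases le_or_gt (w x) 0 with h | h
      · rw [posPow_of_nonpos (by norm_num) h, zero_mul]
      · exact mul_nonneg (posPow_nonneg _ _) (hsub x h)
    have e2 : posPow 4 (w x) * posPow 2 (w x) = posPow 3 (w x) ^ 2 := by
      unfold posPow; ring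
    have e3 : v x = 1 + posPow 4 (w x) := rfl
    have h2 := posPow_nonneg 2 (w x)
    have : 1 / 2 * (v x * v x ^ ((1 : ℝ) / 2 - 2))
          * (12 * posPow 2 (w x) * gradSq w x + 4 * posPow 3 (w x) * lap w x) * 1
        + 1 / 2 * (1 / 2 - 1) * v x ^ ((1 : ℝ) / 2 - 2)
          * (16 * posPow 3 (w x) ^ 2 * gradSq w x) * 1
        + 2 * (1 / 2) * (v x * v x ^ ((1 : ℝ) / 2 - 2)) * 0 + v x ^ (1 / 2 : ℝ) * 0
        = v x ^ ((1 : ℝ) / 2 - 2) * (6 * posPow 2 (w x) * gradSq w x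
          + 2 * posPow 3 (w x) ^ 2 * gradSq w x + 2 * v x * (posPow 3 (w x) * lap w x)) := by
      rw [← e2, e3]; ring
    rw [this]
    have hvx := hv0 x
    positivity
  have hz := eq_zero_of_subharmonic hf hf0 hlap x₀ hk hθ fun R hR => by
    refine le_trans ?_ (hb R hR)
    refine mul_le_mul_of_nonneg_left ?_ (by positivity)
    have hcs := hasCompactSupport_cut x₀ hR (m := k + 1) (by omega)
    have i1 : Continuous fun x => f x * cut x₀ R (k + 1) x :=
      hf.continuous.mul (continuous_cut _ _ _)
    have i2 : Continuous fun x => w x ^ 2 * cut x₀ R (k + 1) x :=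
      (hw.continuous.pow 2).mul (continuous_cut _ _ _)
    exact integral_mono (i1.integrable_of_hasCompactSupport hcs.mul_left)
      (i2.integrable_of_hasCompactSupport hcs.mul_left)
      fun x => mul_le_mul_of_nonneg_right (hf1 x) (cut_nonneg _ _ _ _)
  by_contra! hpos
  have h1 : 1 < v x₀ := by
    simp only [hv_def]
    rw [posPow_of_nonneg 4 hpos.le]
    have := pow_pos hpos 4
    linarith
  have := one_lt_rpow h1 (show (0 : ℝ) < 1 / 2 by norm_num)
  simp only [hf_def] at hz
  linarith

/-- Pointwise comparison of `u ^ ((p + 1) / 2)` and `-Δu` for stable solutions. -/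
lemma rpow_le_neg_lap {u : ESp n → ℝ} {p : ℝ} (hu : ContDiff ℝ 4 u) (hpos : ∀ x, 0 < u x)
    (hp : 1 < p) (heq : ∀ x, lap (lap u) x = u x ^ p)
    (hstab : ∀ φ : ESp n → ℝ, ContDiff ℝ (⊤ : ℕ∞) φ → HasCompactSupport φ →
      p * ∫ x, u x ^ (p - 1) * φ x ^ 2 ≤ ∫ x, (lap φ x) ^ 2) (x : ESp n) :
    √(2 / (p + 1)) * u x ^ ((p + 1) / 2) ≤ -lap u x := by
  have hu2 : ContDiff ℝ 2 u := hu.of_le (by norm_num)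
  have hl2 : ContDiff ℝ 2 (lap u) := ContDiff.lap_cd (k := 2) hu
  set c := √(2 / (p + 1)) with hc_def
  have hc2 : c ^ 2 = 2 / (p + 1) := sq_sqrt (by positivity)
  have hc0 : 0 < c := sqrt_pos.2 (by positivity)
  have hq2 : ContDiff ℝ 2 fun y => u y ^ ((p + 1) / 2) :=
    hu2.rpow_const_of_ne fun x => (hpos x).ne'
  have hcd : ContDiff ℝ 2 fun _ : ESp n => c := contDiff_const
  set w : ESp n → ℝ := fun y => u y ^ ((p + 1) / 2) * (fun _ => c) y + lap u y with hw_def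
  have hw : ContDiff ℝ 2 w := (hq2.mul hcd).add hl2
  have hsub : ∀ y, 0 < w y → 0 ≤ lap w y := by
    intro y hy
    rw [hw_def, lap_add (hq2.mul hcd) hl2, heq, lap_rpow_mul hu2 hpos contDiff_const, gradDot_const,
      lap_const]
    have hL : lap u y = w y - c * u y ^ ((p + 1) / 2) := by simp only [hw_def]; ring
    have e1 : u y ^ p = u y ^ ((p + 1) / 2 - 1) * u y ^ ((p + 1) / 2) := by
      rw [← rpow_add (hpos y)]; ring_nf
    have hcq : c ^ 2 * ((p + 1) / 2) = 1 := by rw [hc2]; field_simp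
    rw [hL, e1]
    have hA := rpow_pos_of_pos (hpos y) ((p + 1) / 2 - 1)
    have hB := rpow_pos_of_pos (hpos y) ((p + 1) / 2 - 2)
    have hG := gradSq_nonneg u y
    generalize u y ^ ((p + 1) / 2 - 1) = A at *
    generalize u y ^ ((p + 1) / 2 - 2) = B at *
    have h1 : 0 ≤ (p + 1) / 2 * A * w y * c := by positivity
    have h2 : 0 ≤ (p + 1) / 2 * ((p + 1) / 2 - 1) * B * gradSq u y * c := by
      have : 0 ≤ (p + 1) / 2 - 1 := by linarith
      positivity
    have h3 : (p + 1) / 2 * A * (w y - c * u y ^ ((p + 1) / 2)) * c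
        = (p + 1) / 2 * A * w y * c - A * u y ^ ((p + 1) / 2) * (c ^ 2 * ((p + 1) / 2)) := by
      ring
    rw [h3, hcq]
    linarith
  obtain ⟨m, hm⟩ := exists_nat_ge (2 + 2 * ((0 + 2) / (p - 1)))
  have hm0 : 3 ≤ m := three_le_of_bound hp le_rfl hm
  obtain ⟨C, hC, hE⟩ := energy_le_of_zero (x₀ := x) hu hpos hp hm heq hstab
  have hw2 : ∀ y, w y ^ 2 ≤ (2 * c ^ 2 + 2) * dens u p y := by
    intro y
    have h1 := sq_rpow_le_dens (p := p) hpos y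
    have h2 : lap u y ^ 2 ≤ dens u p y := by
      have := hessSq_nonneg u y
      have := rpow_pos_of_pos (hpos y) (p + 1)
      unfold dens
      nlinarith [sq_nonneg (gradSq u y / u y)]
    have h3 : w y ^ 2 ≤ 2 * c ^ 2 * (u y ^ ((p + 1) / 2)) ^ 2 + 2 * lap u y ^ 2 := by
      simp only [hw_def]
      nlinarith [sq_nonneg (u y ^ ((p + 1) / 2) * c - lap u y)]
    have h4 := mul_le_mul_of_nonneg_left h1 (show 0 ≤ 2 * c ^ 2 by positivity)
    linarith
  have hθ : 0 < 4 + 4 * ((0 + 2) / (p - 1)) := by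
    have : 0 < p - 1 := by linarith
    positivity
  have := nonpos_of_subharmonic hw hsub (k := 2 * m - 1) (by omega) hθ x
    (C := (2 * c ^ 2 + 2) * C) fun R hR => by
      rw [show 2 * m - 1 + 1 = 2 * m by omega]
      have h1 : ∫ y, w y ^ 2 * cut x R (2 * m) y
          ≤ (2 * c ^ 2 + 2) * wInt u 0 x m R (dens u p) := by
        have e : ∫ y, w y ^ 2 * cut x R (2 * m) y = wInt u 0 x m R fun y => w y ^ 2 := by
          unfold wInt wt
          refine integral_congr_ae (Filter.Eventually.of_forall fun y => ?_)
          simp only [rpow_zero, one_mul]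
          ring
        rw [e, ← wInt_const_mul]
        exact wInt_mono hu.continuous hpos (by omega) hR (hw.continuous.pow 2)
          (continuous_const.mul (continuous_dens hu2 hpos)) hw2
      have h2 : (R ^ n)⁻¹ * R ^ ((n : ℝ) - (4 + 4 * ((0 + 2) / (p - 1))))
          = R ^ (-(4 + 4 * ((0 + 2) / (p - 1)))) := by
        rw [← rpow_natCast, ← rpow_neg hR.le, ← rpow_add hR]
        congr 1
        ring
      calc (R ^ n)⁻¹ * ∫ y, w y ^ 2 * cut x R (2 * m) y
          ≤ (R ^ n)⁻¹ * ((2 * c ^ 2 + 2)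
            * (C * R ^ ((n : ℝ) - (4 + 4 * ((0 + 2) / (p - 1)))))) := by
            refine mul_le_mul_of_nonneg_left (h1.trans ?_) (by positivity)
            exact mul_le_mul_of_nonneg_left (hE R hR) (by positivity)
        _ = (2 * c ^ 2 + 2) * C * R ^ (-(4 + 4 * ((0 + 2) / (p - 1)))) := by
            rw [← h2]; ring
  simp only [hw_def] at this
  linarith

end PointwiseBound

section Nonexistence

variable {n : ℕ} {u : ESp n → ℝ} {p : ℝ}

/-- The energy cannot be bounded by a negative power of the radius. -/
lemma not_energy_le {s β C : ℝ} {x₀ : ESp n} {m : ℕ} (hu : ContDiff ℝ 2 u) (hpos : ∀ x, 0 < u x)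
    (hm : m ≠ 0) (hβ : (n : ℝ) - β < 0)
    (h : ∀ R > 0, wInt u s x₀ m R (dens u p) ≤ C * R ^ ((n : ℝ) - β)) : False := by
  have hlim : Filter.Tendsto (fun R : ℝ => C * R ^ ((n : ℝ) - β)) Filter.atTop (nhds 0) := by
    simpa using (tendsto_rpow_neg_atTop (sub_pos.2 (sub_neg.1 hβ))).const_mul C
  have hc : Continuous fun x => wt u s x₀ m 1 x * dens u p x :=
    (continuous_wt hu.continuous hpos s m 1).mul (continuous_dens hu hpos)
  have h1 : wInt u s x₀ m 1 (dens u p) ≤ 0 := by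
    refine ge_of_tendsto hlim ?_
    filter_upwards [Filter.eventually_ge_atTop 1] with R hR
    have hR0 : 0 < R := by linarith
    refine le_trans ?_ (h R hR0)
    refine integral_mono
      (integrable_wt_mul hu.continuous hpos s hm one_pos (continuous_dens hu hpos))
      (integrable_wt_mul hu.continuous hpos s hm hR0 (continuous_dens hu hpos)) fun x => ?_
    refine mul_le_mul_of_nonneg_right ?_ (dens_nonneg hpos x)
    exact mul_le_mul_of_nonneg_left (cut_mono x₀ one_pos hR _ x) (rpow_nonneg (hpos x).le _)
  have h2 : 0 < wInt u s x₀ m 1 (dens u p) := by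
    refine hc.integral_pos_of_hasCompactSupport_nonneg_nonzero
      (hasCompactSupport_wt s hm one_pos).mul_right
      (fun x => mul_nonneg (wt_nonneg hpos s m 1 x) (dens_nonneg hpos x)) (x := x₀) ?_
    have hw : 0 < wt u s x₀ m 1 x₀ := by
      have : cut x₀ 1 (2 * m) x₀ = 1 := by simp [cut, quadBump, posPow]
      rw [wt, this, mul_one]
      exact rpow_pos_of_pos (hpos x₀) _
    have hd : 0 < dens u p x₀ := by
      have := hessSq_nonneg u x₀
      have := rpow_pos_of_pos (hpos x₀) (p + 1)
      unfold dens
      positivity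
    exact (mul_pos hw hd).ne'
  linarith

/-- The gap in the stability inequality for test functions of the form `u ^ γ`. -/
noncomputable def stabilityGap (p γ : ℝ) : ℝ :=
  p * (2 * γ - 1) - γ ^ 2
    - 4 * γ ^ 2 * (γ - 1) ^ 2 / (3 - 2 * γ)
      * (1 / (2 * γ - 1) - 2 / ((p + 1) * (p + 4 * γ - 3)))

lemma exists_gt_stabilityGap_pos (hp : 1 < p) {γ₀ : ℝ} (h1 : 1 ≤ γ₀) (h2 : γ₀ < 3 / 2)
    (h : 0 < stabilityGap p γ₀) : ∃ γ, γ₀ < γ ∧ γ < 3 / 2 ∧ 0 < stabilityGap p γ := by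
  have hc : ContinuousAt (stabilityGap p) γ₀ := by
    unfold stabilityGap
    have e1 : 3 - 2 * γ₀ ≠ 0 := by linarith
    have e2 : 2 * γ₀ - 1 ≠ 0 := by linarith
    have e3 : (p + 1) * (p + 4 * γ₀ - 3) ≠ 0 :=
      (mul_pos (by linarith) (by linarith)).ne'
    fun_prop (disch := assumption)
  have hev : ∀ᶠ γ in nhdsWithin γ₀ (Set.Ioi γ₀), γ < 3 / 2 ∧ 0 < stabilityGap p γ :=
    nhdsWithin_le_nhds ((eventually_lt_nhds h2).and (hc.eventually (eventually_gt_nhds h)))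
  obtain ⟨γ, hγ, hγ'⟩ := (hev.and self_mem_nhdsWithin).exists
  exact ⟨γ, hγ', hγ.1, hγ.2⟩

lemma false_of_stable_of_lt (hu : ContDiff ℝ 4 u) (hpos : ∀ x, 0 < u x) (hp : 1 < p)
    (heq : ∀ x, lap (lap u) x = u x ^ p)
    (hstab : ∀ φ : ESp n → ℝ, ContDiff ℝ (⊤ : ℕ∞) φ → HasCompactSupport φ →
      p * ∫ x, u x ^ (p - 1) * φ x ^ 2 ≤ ∫ x, (lap φ x) ^ 2)
    (hn : (p - 1) * ((n : ℝ) - 4) / 8 < 1) : False := by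
  have hp' : 0 < p - 1 := by linarith
  obtain ⟨m, hm⟩ := exists_nat_ge (2 + 2 * ((0 + 2) / (p - 1)))
  obtain ⟨C, -, hC⟩ := energy_le_of_zero (x₀ := 0) hu hpos hp hm heq hstab
  have hm0 := three_le_of_bound hp le_rfl hm
  refine not_energy_le (hu.of_le (by norm_num)) hpos (by omega) ?_ hC
  have : (n : ℝ) - 4 < 4 * ((0 + 2) / (p - 1)) := by
    rw [← mul_div_assoc, lt_div_iff₀ hp']
    linarith
  linarith

lemma false_of_stable_of_stabilityGap_pos (hu : ContDiff ℝ 4 u) (hpos : ∀ x, 0 < u x)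
    (hp : 1 < p) (heq : ∀ x, lap (lap u) x = u x ^ p)
    (hstab : ∀ φ : ESp n → ℝ, ContDiff ℝ (⊤ : ℕ∞) φ → HasCompactSupport φ →
      p * ∫ x, u x ^ (p - 1) * φ x ^ 2 ≤ ∫ x, (lap φ x) ^ 2)
    {γ : ℝ} (hn : (p - 1) * ((n : ℝ) - 4) / 8 < γ) (h1 : 1 < γ) (h2 : γ < 3 / 2)
    (hγ : 0 < stabilityGap p γ) : False := by
  have hp' : 0 < p - 1 := by linarith
  obtain ⟨m, hm⟩ := exists_nat_ge (2 + 2 * ((2 * γ - 2 + 2) / (p - 1)))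
  have hs : 0 < 2 * γ - 2 := by linarith
  have hm0 := three_le_of_bound hp hs.le hm
  have hL : ((2 * γ - 2) / 2 + 1) ^ 2 * (1 / (2 * γ - 2 + 1) + (2 * γ - 2) ^ 2
      / (1 - (2 * γ - 2) ^ 2) * (1 / (2 * γ - 2 + 1)
        - √(2 / (p + 1)) ^ 2 / (2 * γ - 2 + (p + 1) / 2) / 2)) < p := by
    have a1 : 0 < 2 * γ - 1 := by linarith
    have a2 : 0 < 3 - 2 * γ := by linarith
    have a3 : 0 < p + 4 * γ - 3 := by linarith
    have a4 : 0 < p + 1 := by linarith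
    have e : p - ((2 * γ - 2) / 2 + 1) ^ 2 * (1 / (2 * γ - 2 + 1) + (2 * γ - 2) ^ 2
        / (1 - (2 * γ - 2) ^ 2) * (1 / (2 * γ - 2 + 1)
          - √(2 / (p + 1)) ^ 2 / (2 * γ - 2 + (p + 1) / 2) / 2))
        = stabilityGap p γ / (2 * γ - 1) := by
      rw [sq_sqrt (by positivity), stabilityGap,
        show 2 * γ - 2 + 1 = 2 * γ - 1 by ring,
        show 1 - (2 * γ - 2) ^ 2 = (3 - 2 * γ) * (2 * γ - 1) by ring,
        show 2 * γ - 2 + (p + 1) / 2 = (p + 4 * γ - 3) / 2 by ring]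
      field_simp
      ring
    have := div_pos hγ a1
    linarith
  obtain ⟨C, -, hC⟩ := energy_le_of_pos (x₀ := 0) hu hpos hp hs (by linarith) hm heq hstab
    (sqrt_pos.2 (by positivity)) (rpow_le_neg_lap hu hpos hp heq hstab) hL
  refine not_energy_le (hu.of_le (by norm_num)) hpos (by omega) ?_ hC
  have : (n : ℝ) - 4 < 4 * ((2 * γ - 2 + 2) / (p - 1)) := by
    rw [← mul_div_assoc, lt_div_iff₀ hp']
    linarith
  linarith

end Nonexistence

section Polynomial

variable {n : ℕ}

lemma Pn_neg_of_le (hn : 20 ≤ n) (hn' : n ≤ 36) {x : ℝ} (hx : ((n : ℝ) - 4) / ((n : ℝ) - 8) < x) :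
    Pn n x < 0 := by
  obtain ⟨y, hy, rfl⟩ : ∃ y > 0, x = ((n : ℝ) - 4) / ((n : ℝ) - 8) + y :=
    ⟨x - ((n : ℝ) - 4) / ((n : ℝ) - 8), sub_pos.2 hx, by ring⟩
  have h2 := pow_pos hy 2
  have h3 := pow_pos hy 3
  have h4 := pow_pos hy 4
  have h5 := pow_pos hy 5
  have h6 := pow_pos hy 6
  clear hx
  unfold Pn
  interval_cases n <;> norm_num <;> linarith only [hy, h2, h3, h4, h5, h6]

lemma Pn_pos_of_le_div (hn : 37 ≤ n) {x : ℝ} (h1 : 1 ≤ x)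
    (hx : x ≤ ((n : ℝ) - 4) / ((n : ℝ) - 8)) : 0 < Pn n x := by
  have hn' : (37 : ℝ) ≤ n := by exact_mod_cast hn
  obtain ⟨k, hk, hnk⟩ : ∃ k : ℝ, 0 ≤ k ∧ (n : ℝ) = 37 + k := ⟨n - 37, by linarith, by ring⟩
  have hd : 0 < 29 + k := by linarith
  obtain ⟨t, rfl⟩ : ∃ t, x = 1 + 4 * t / (29 + k) := ⟨(x - 1) * (29 + k) / 4, by field_simp; ring⟩
  have ht0 : 0 ≤ t := by
    by_contra! h
    have := div_neg_of_neg_of_pos (show 4 * t < 0 by linarith) hd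
    linarith
  have ht1 : t ≤ 1 := by
    rw [hnk, show 37 + k - 8 = 29 + k by ring, le_div_iff₀ hd, add_mul,
      div_mul_cancel₀ _ hd.ne'] at hx
    linarith
  obtain ⟨a, ha⟩ : ∃ z : ℝ, z = 2112812436192 + 670304349320 * k + 90684740696 * k ^ 2 +
  6875941992 * k ^ 3 + 320891960 * k ^ 4 + 9465368 * k ^ 5 + 172680 * k ^ 6 + 1784 * k ^ 7 + 8 *
  k ^ 8 := ⟨_, rfl⟩
  obtain ⟨b, hb⟩ : ∃ z : ℝ, z = 1457112024960 + 412033619360 * k + 48333144640 * k ^ 2 +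
  3075368800 * k ^ 3 + 115257600 * k ^ 4 + 2553440 * k ^ 5 + 31040 * k ^ 6 + 160 * k ^ 7 := ⟨_,
  rfl⟩
  obtain ⟨c, hc⟩ : ∃ z : ℝ, z = 2059183561648 + 420830438992 * k + 37012167792 * k ^ 2 +
  1823763600 * k ^ 3 + 54655760 * k ^ 4 + 1001712 * k ^ 5 + 10448 * k ^ 6 + 48 * k ^ 7 := ⟨_,
  rfl⟩
  obtain ⟨d, hd'⟩ : ∃ z : ℝ, z = 1199083428992 + 207928786176 * k + 14925027712 * k ^ 2 +
  567787008 * k ^ 3 + 12081024 * k ^ 4 + 136448 * k ^ 5 + 640 * k ^ 6 := ⟨_, rfl⟩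
  obtain ⟨e, he⟩ : ∃ z : ℝ, z = 172582565376 + 22903440896 * k + 1183085568 * k ^ 2 + 29488128 *
  k ^ 3 + 349696 * k ^ 4 + 1536 * k ^ 5 := ⟨_, rfl⟩
  obtain ⟨f, hf⟩ : ∃ z : ℝ, z = 4148056064 + 194232320 * k := ⟨_, rfl⟩
  obtain ⟨f', hf'⟩ : ∃ z : ℝ, z = 4292608 * k ^ 2 + 327680 * k ^ 3 + 4096 * k ^ 4 := ⟨_, rfl⟩
  obtain ⟨g, hg⟩ : ∃ z : ℝ, z = 73400320 + 2097152 * k := ⟨_, rfl⟩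
  have key : (29 + k) ^ 6 * Pn n (1 + 4 * t / (29 + k))
      = a + b * t - c * t ^ 2 - d * t ^ 3 - e * t ^ 4 - f * t ^ 5 + f' * t ^ 5 - g * t ^ 6 := by
    subst ha hb hc hd' he hf hf' hg
    unfold Pn
    rw [hnk]
    field_simp
    ring
  have hsum : 0 < a + b - c - d - e - f - g := by
    subst ha hb hc hd' he hf hf' hg
    ring_nf
    positivity
  have pa : 0 ≤ a := by rw [ha]; positivity
  have pc : 0 ≤ c := by rw [hc]; positivity
  have pd' : 0 ≤ d := by rw [hd']; positivity
  have pe : 0 ≤ e := by rw [he]; positivity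
  have pf : 0 ≤ f := by rw [hf]; positivity
  have pf' : 0 ≤ f' := by rw [hf']; positivity
  have pg : 0 ≤ g := by rw [hg]; positivity
  have hpow : ∀ j : ℕ, j ≠ 0 → t ^ j ≤ t := fun j hj => pow_le_of_le_one ht0 ht1 hj
  have qc := mul_le_mul_of_nonneg_left (hpow 2 (by norm_num)) pc
  have qd := mul_le_mul_of_nonneg_left (hpow 3 (by norm_num)) pd'
  have qe := mul_le_mul_of_nonneg_left (hpow 4 (by norm_num)) pe
  have qf := mul_le_mul_of_nonneg_left (hpow 5 (by norm_num)) pf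
  have qf' := mul_nonneg pf' (pow_nonneg ht0 5)
  have qg := mul_le_mul_of_nonneg_left (hpow 6 (by norm_num)) pg
  have hpos : 0 < (29 + k) ^ 6 * Pn n (1 + 4 * t / (29 + k)) := by
    have hlin : 0 < (1 - t) * a + t * (a + b - c - d - e - f - g) := by
      have pa' : 0 < a := by rw [ha]; positivity
      rcases ht0.eq_or_lt with h | h
      · rw [← h]; linarith
      · have := mul_pos h hsum
        have := mul_nonneg (sub_nonneg.2 ht1) pa
        linarith
    rw [key]
    linarith only [hlin, qc, qd, qe, qf, qf', qg]
  exact pos_of_mul_pos_right hpos (by positivity)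

lemma Pn_three_halves_neg (hn : 37 ≤ n) : Pn n (3 / 2) < 0 := by
  have hn' : (37 : ℝ) ≤ n := by exact_mod_cast hn
  obtain ⟨k, hk, hnk⟩ : ∃ k : ℝ, 0 ≤ k ∧ (n : ℝ) = 37 + k := ⟨n - 37, by linarith, by ring⟩
  unfold Pn
  rw [hnk]
  have h2 := pow_nonneg hk 2
  have h3 := pow_nonneg hk 3
  linarith only [hk, h2, h3]

lemma stabilityGap_pos_of_Pn_pos (hn : 37 ≤ n) {x : ℝ} (h1 : 1 ≤ x) (h2 : x < 3 / 2)
    (h : 0 < Pn n x) : 0 < stabilityGap (1 + 8 * x / ((n : ℝ) - 4)) x := by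
  have hn' : (37 : ℝ) ≤ n := by exact_mod_cast hn
  obtain ⟨N, hN, hnN⟩ : ∃ N : ℝ, 0 < N ∧ (n : ℝ) = N + 4 := ⟨n - 4, by linarith, by ring⟩
  have a1 : 0 < 3 - 2 * x := by linarith
  have a2 : 0 < 2 * x - 1 := by linarith
  have a3 : 0 < N + 4 * x := by linarith
  have a4 : 0 < (2 * x - 1) * N + 4 * x := by positivity
  have key : (3 - 2 * x) * (2 * x - 1) * ((N + 4 * x) * ((2 * x - 1) * N + 4 * x)) * N
      * stabilityGap (1 + 8 * x / N) x = Pn n x + 200 * n * x ^ 5 := by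
    have e : (1 + 8 * x / N + 1) * (1 + 8 * x / N + 4 * x - 3)
        = 4 * ((N + 4 * x) * ((2 * x - 1) * N + 4 * x)) / N ^ 2 := by
      field_simp
      ring
    unfold stabilityGap Pn
    rw [e, hnN]
    field_simp
    ring
  rw [hnN, add_sub_cancel_right]
  refine pos_of_mul_pos_right (a := (3 - 2 * x) * (2 * x - 1)
    * ((N + 4 * x) * ((2 * x - 1) * N + 4 * x)) * N) ?_ (by positivity)
  rw [key]
  have : 0 ≤ x := by linarith
  positivity

lemma Pn_pos_of_lt (hn : 37 ≤ n) {r x : ℝ}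
    (hmin : ∀ y : ℝ, ((n : ℝ) - 4) / ((n : ℝ) - 8) < y → Pn n y = 0 → r ≤ y)
    (h1 : 1 ≤ x) (hx : x < r) : 0 < Pn n x := by
  rcases le_or_gt x (((n : ℝ) - 4) / ((n : ℝ) - 8)) with h | h
  · exact Pn_pos_of_le_div hn h1 h
  · by_contra! hneg
    have hn' : (37 : ℝ) ≤ n := by exact_mod_cast hn
    have hr : 0 < Pn n (((n : ℝ) - 4) / ((n : ℝ) - 8)) := by
      refine Pn_pos_of_le_div hn ?_ le_rfl
      rw [one_le_div (by linarith)]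
      linarith
    have hc : ContinuousOn (Pn n) (Set.Icc (((n : ℝ) - 4) / ((n : ℝ) - 8)) x) := by
      unfold Pn; fun_prop
    obtain ⟨y, hy, hy0⟩ := intermediate_value_Icc' h.le hc ⟨hneg, hr.le⟩
    have hlt : ((n : ℝ) - 4) / ((n : ℝ) - 8) < y := by
      refine hy.1.lt_of_ne fun he => ?_
      rw [he, hy0] at hr
      exact lt_irrefl _ hr
    linarith [hmin y hlt hy0, hy.2]

end Polynomial

theorem stmt_2 (n : ℕ) (hn : 20 ≤ n) (pstar : ℝ)
    (hroot : Pn n pstar = 0)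
    (hgt : ((n : ℝ) - 4)/((n : ℝ) - 8) < pstar)
    (hmin : ∀ x : ℝ, ((n : ℝ) - 4)/((n : ℝ) - 8) < x → Pn n x = 0 → pstar ≤ x)
    (p : ℝ) (hp1 : 1 < p) (hp2 : p < 1 + 8*pstar/((n : ℝ) - 4)) :
    ¬ ∃ u : EuclideanSpace ℝ (Fin n) → ℝ,
      ContDiff ℝ 4 u ∧ (∀ x, 0 < u x) ∧ (∀ x, lap (lap u) x = u x ^ p) ∧
      (∀ φ : EuclideanSpace ℝ (Fin n) → ℝ, ContDiff ℝ (⊤ : ℕ∞) φ →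
        HasCompactSupport φ →
        p * ∫ x, u x ^ (p - 1) * φ x ^ 2 ≤ ∫ x, (lap φ x) ^ 2) := by
  rintro ⟨u, hu, hpos, heq, hstab⟩
  rcases le_or_gt n 36 with h36 | h36
  · exact (Pn_neg_of_le hn h36 hgt).ne hroot
  have hn' : (37 : ℝ) ≤ n := by exact_mod_cast h36
  have hN : 0 < (n : ℝ) - 4 := by linarith
  set γ₀ : ℝ := (p - 1) * ((n : ℝ) - 4) / 8 with hγ₀
  have hpγ : p = 1 + 8 * γ₀ / ((n : ℝ) - 4) := by
    rw [hγ₀]; field_simp; ring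
  have hlt : γ₀ < pstar := by
    rw [hpγ, add_lt_add_iff_left, div_lt_div_iff_of_pos_right hN] at hp2
    linarith
  rcases lt_or_ge γ₀ 1 with h1 | h1
  · exact false_of_stable_of_lt hu hpos hp1 heq hstab h1
  have h2 : γ₀ < 3 / 2 := by
    by_contra! h
    exact (Pn_three_halves_neg h36).not_gt
      (Pn_pos_of_lt h36 hmin (by norm_num) (h.trans_lt hlt))
  have hgap := stabilityGap_pos_of_Pn_pos h36 h1 h2 (Pn_pos_of_lt h36 hmin h1 hlt)
  rw [← hpγ] at hgap
  obtain ⟨γ, hγ, hγ2, hγpos⟩ := exists_gt_stabilityGap_pos hp1 h1 h2 hgap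
  exact false_of_stable_of_stabilityGap_pos hu hpos hp1 heq hstab hγ (h1.trans_lt hγ) hγ2 hγpos
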